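/- arXiv:1508.00098 — 5 statements merged into one kernel-verified Lean document; each statement's English description precedes it below -/
import Mathlib

section
/- For every v ∈ {37, 46, 52, 76, 88} there exists a super-simple 2-(v,4,2) directed design whose every defining set contains at least half of the total number of blocks. -/
/-- A `t-(v,k,λ)` directed design on the point type `X`: a collection of
blocks, each an ordered `k`-tuple (a duplicate-free list of length `k`) of
points, such that every ordered `t`-tuple of distinct points occurs, in the
given order (i.e. as a sublist), in exactly `lam` blocks. -/
structure DirectedDesign (X : Type*) [DecidableEq X] (t k lam : ℕ) where
  blocks : Multiset (List X)
  len : ∀ b ∈ blocks, b.length = k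
  nodup : ∀ b ∈ blocks, b.Nodup
  covers : ∀ s : List X, s.length = t → s.Nodup →
    blocks.countP (fun b => s.Sublist b) = lam

/-- A directed design is super-simple if it has no repeated blocks and any two
distinct blocks have at most 2 points in common. -/
def DirectedDesign.SuperSimple {X : Type*} [DecidableEq X] {t k lam : ℕ}
    (D : DirectedDesign X t k lam) : Prop :=
  D.blocks.Nodup ∧
    ∀ b₁ ∈ D.blocks, ∀ b₂ ∈ D.blocks, b₁ ≠ b₂ →
      (b₁.toFinset ∩ b₂.toFinset).card ≤ 2

/-- `S` is a defining set of the directed design `D` if `S` is a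
subcollection of the blocks of `D` and `D.blocks` is the unique block
collection of a `t-(v,k,λ)` directed design on the same point set
containing `S`. -/
def DirectedDesign.IsDefiningSet {X : Type*} [DecidableEq X] {t k lam : ℕ}
    (D : DirectedDesign X t k lam) (S : Multiset (List X)) : Prop :=
  S ≤ D.blocks ∧
    ∀ D' : DirectedDesign X t k lam, S ≤ D'.blocks → D'.blocks = D.blocks

/-- Every defining set of `D` contains at least half of the blocks
(the paper's condition `d ≥ 1/2`). -/
def DirectedDesign.DefiningHalf {X : Type*} [DecidableEq X] {t k lam : ℕ}
    (D : DirectedDesign X t k lam) : Prop :=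
  ∀ S : Multiset (List X), D.IsDefiningSet S →
    Multiset.card D.blocks ≤ 2 * Multiset.card S

/-- A `(v,k,t)` directed trade `T = T₁ - T₂`: two disjoint nonempty
collections of blocks of the same volume such that every ordered `t`-tuple
of distinct points is covered by equally many blocks of `T₁` as of `T₂`. -/
structure DirectedTrade (X : Type*) [DecidableEq X] (k t : ℕ) where
  pos : Multiset (List X)
  neg : Multiset (List X)
  pos_len : ∀ b ∈ pos, b.length = k
  pos_nodup : ∀ b ∈ pos, b.Nodup
  neg_len : ∀ b ∈ neg, b.length = k
  neg_nodup : ∀ b ∈ neg, b.Nodup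
  disjoint : Disjoint pos neg
  pos_ne : pos ≠ 0
  card_eq : Multiset.card pos = Multiset.card neg
  balanced : ∀ s : List X, s.length = t → s.Nodup →
    pos.countP (fun b => s.Sublist b) = neg.countP (fun b => s.Sublist b)

/-- A `(k,λ)` directed group divisible design (DGDD) with the given group set
`groups`: blocks are ordered `k`-tuples of distinct points meeting each group
in at most one point, and every ordered pair of distinct points from
different groups occurs, in order, in exactly `lam` blocks. -/
structure DGDD (X : Type*) [DecidableEq X] (groups : Finset (Finset X))
    (k lam : ℕ) where
  blocks : Multiset (List X)
  len : ∀ b ∈ blocks, b.length = k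
  nodup : ∀ b ∈ blocks, b.Nodup
  transverse : ∀ b ∈ blocks, ∀ G ∈ groups, (b.toFinset ∩ G).card ≤ 1
  covers : ∀ x y : X, x ≠ y → (∀ G ∈ groups, ¬(x ∈ G ∧ y ∈ G)) →
    blocks.countP (fun b => [x, y].Sublist b) = lam

/-- A DGDD is super-simple if it has no repeated blocks and any two distinct
blocks have at most 2 points in common. -/
def DGDD.SuperSimple {X : Type*} [DecidableEq X] {groups : Finset (Finset X)}
    {k lam : ℕ} (D : DGDD X groups k lam) : Prop :=
  D.blocks.Nodup ∧
    ∀ b₁ ∈ D.blocks, ∀ b₂ ∈ D.blocks, b₁ ≠ b₂ →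
      (b₁.toFinset ∩ b₂.toFinset).card ≤ 2

/-- `S` is a defining set of the DGDD `D` if `S` is a subcollection of the
blocks of `D` and `D.blocks` is the unique block collection of a
`(k,λ)`-DGDD with the same groups containing `S`. -/
def DGDD.IsDefiningSet {X : Type*} [DecidableEq X] {groups : Finset (Finset X)}
    {k lam : ℕ} (D : DGDD X groups k lam) (S : Multiset (List X)) : Prop :=
  S ≤ D.blocks ∧
    ∀ D' : DGDD X groups k lam, S ≤ D'.blocks → D'.blocks = D.blocks

/-- Every defining set of the DGDD `D` contains at least half of the blocks. -/
def DGDD.DefiningHalf {X : Type*} [DecidableEq X] {groups : Finset (Finset X)}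
    {k lam : ℕ} (D : DGDD X groups k lam) : Prop :=
  ∀ S : Multiset (List X), D.IsDefiningSet S →
    Multiset.card D.blocks ≤ 2 * Multiset.card S

/-- A (undirected) `(K,λ)` group divisible design with the given group set
`groups`: blocks are subsets of the point set with sizes in `K` meeting each
group in at most one point, and every pair of distinct points from different
groups lies in exactly `lam` blocks. -/
structure GDD (X : Type*) [DecidableEq X] (groups : Finset (Finset X))
    (K : Finset ℕ) (lam : ℕ) where
  blocks : Multiset (Finset X)
  size_mem : ∀ b ∈ blocks, b.card ∈ K
  transverse : ∀ b ∈ blocks, ∀ G ∈ groups, (b ∩ G).card ≤ 1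
  covers : ∀ x y : X, x ≠ y → (∀ G ∈ groups, ¬(x ∈ G ∧ y ∈ G)) →
    blocks.countP (fun b => x ∈ b ∧ y ∈ b) = lam

/-- `groups` is a partition of the point type `X`: every point lies in
exactly one group. -/
def IsGroupPartition {X : Type*} (groups : Finset (Finset X)) : Prop :=
  ∀ x : X, ∃! G, G ∈ groups ∧ x ∈ G

set_option linter.unusedSectionVars false

section CyclicConstruction

theorem pair_sublist_ofFn {G : Type*} (f : Fin 4 → G) (x y : G) :
    [x, y].Sublist (List.ofFn f) ↔ ∃ k l : Fin 4, k < l ∧ f k = x ∧ f l = y := by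
  simp only [List.ofFn_succ, List.ofFn_zero]
  constructor
  · intro h
    have h2 : (x = f 0 ∧ (y = f 1 ∨ y = f 2 ∨ y = f 3)) ∨ (x = f 1 ∧ (y = f 2 ∨ y = f 3)) ∨
        (x = f 2 ∧ y = f 3) := by
      have e1 : (Fin.succ (0 : Fin 3)) = 1 := rfl
      have e2 : (Fin.succ (Fin.succ (0 : Fin 2))) = 2 := rfl
      have e3 : (Fin.succ (Fin.succ (Fin.succ (0 : Fin 1)))) = 3 := rfl
      simp only [e1, e2, e3, List.sublist_cons_iff, List.cons.injEq] at h
      simp only [List.sublist_nil] at h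
      grind
    rcases h2 with ⟨h, h' | h' | h'⟩ | ⟨h, h' | h'⟩ | ⟨h, h'⟩
    · exact ⟨0, 1, by decide, h.symm, h'.symm⟩
    · exact ⟨0, 2, by decide, h.symm, h'.symm⟩
    · exact ⟨0, 3, by decide, h.symm, h'.symm⟩
    · exact ⟨1, 2, by decide, h.symm, h'.symm⟩
    · exact ⟨1, 3, by decide, h.symm, h'.symm⟩
    · exact ⟨2, 3, by decide, h.symm, h'.symm⟩
  · rintro ⟨k, l, hkl, rfl, rfl⟩
    have := List.pairwise_iff_get (l := List.finRange 4) (R := (· < ·))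
    have h4 : [k, l].Sublist (List.finRange 4) := by
      revert k l; decide
    have := h4.map f
    simpa [List.finRange_succ] using this

/-- The transposition of two neighbouring positions. -/
def adjSwap (p : Fin 3) : Equiv.Perm (Fin 4) := Equiv.swap p.castSucc p.succ

theorem adjSwap_lt (p : Fin 3) (k l : Fin 4) :
    adjSwap p k < adjSwap p l ↔
      ((k < l ∧ ¬ (k = p.castSucc ∧ l = p.succ)) ∨ (k = p.succ ∧ l = p.castSucc)) := by
  revert p k l; decide

theorem pair_sublist_swap {G : Type*} (f : Fin 4 → G) (p : Fin 3) (x y : G) :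
    [x, y].Sublist (List.ofFn (f ∘ adjSwap p)) ↔
      ∃ k l : Fin 4, adjSwap p k < adjSwap p l ∧ f k = x ∧ f l = y := by
  have hinv : ∀ k, adjSwap p (adjSwap p k) = k := by
    intro k; simp [adjSwap]
  rw [pair_sublist_ofFn]
  constructor
  · rintro ⟨k, l, h, hx, hy⟩
    exact ⟨adjSwap p k, adjSwap p l, by rwa [hinv, hinv], hx, hy⟩
  · rintro ⟨k, l, h, hx, hy⟩
    exact ⟨adjSwap p k, adjSwap p l, h, by simpa [hinv] using hx, by simpa [hinv] using hy⟩

/-- Two blocks containing a pair of neighbours in opposite orders form a trade. -/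
theorem trade_count {G : Type*} [DecidableEq G] (f g : Fin 4 → G)
    (hf : Function.Injective f) (hg : Function.Injective g) (p q : Fin 3)
    (h1 : f p.castSucc = g q.succ) (h2 : f p.succ = g q.castSucc) (x y : G) :
    (if [x, y].Sublist (List.ofFn (f ∘ adjSwap p)) then 1 else 0) +
      (if [x, y].Sublist (List.ofFn (g ∘ adjSwap q)) then 1 else 0) =
    (if [x, y].Sublist (List.ofFn f) then 1 else 0) +
      (if [x, y].Sublist (List.ofFn g) then 1 else 0) := by
  have key : ∀ (f : Fin 4 → G) (hf : Function.Injective f) (p : Fin 3),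
      ([x, y].Sublist (List.ofFn (f ∘ adjSwap p)) ↔
        ([x, y].Sublist (List.ofFn f) ∧ ¬ (x = f p.castSucc ∧ y = f p.succ)) ∨
          (x = f p.succ ∧ y = f p.castSucc)) := by
    intro f hf p
    rw [pair_sublist_swap, pair_sublist_ofFn]
    simp only [adjSwap_lt]
    constructor
    · rintro ⟨k, l, h | ⟨rfl, rfl⟩, rfl, rfl⟩
      · left
        exact ⟨⟨k, l, h.1, rfl, rfl⟩, fun h' => h.2 ⟨hf h'.1, hf h'.2⟩⟩
      · right; exact ⟨rfl, rfl⟩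
    · rintro (⟨⟨k, l, h, rfl, rfl⟩, h'⟩ | ⟨rfl, rfl⟩)
      · refine ⟨k, l, Or.inl ⟨h, fun h'' => h' ⟨by rw [h''.1], by rw [h''.2]⟩⟩, rfl, rfl⟩
      · exact ⟨_, _, Or.inr ⟨rfl, rfl⟩, rfl, rfl⟩
  have kin : ∀ (f : Fin 4 → G) (p : Fin 3), x = f p.castSucc → y = f p.succ →
      [x, y].Sublist (List.ofFn f) := by
    rintro f p rfl rfl
    rw [pair_sublist_ofFn]
    exact ⟨_, _, Fin.castSucc_lt_succ, rfl, rfl⟩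
  have kout : ∀ (f : Fin 4 → G) (hf : Function.Injective f) (p : Fin 3),
      x = f p.succ → y = f p.castSucc → ¬ [x, y].Sublist (List.ofFn f) := by
    rintro f hf p rfl rfl
    rw [pair_sublist_ofFn]
    rintro ⟨k, l, h, hk, hl⟩
    rw [hf hk, hf hl] at h
    exact absurd h (not_lt.mpr Fin.castSucc_lt_succ.le)
  have a1 := kin f p
  have a2 := kin g q
  have b1 := kout f hf p
  have b2 := kout g hg q
  have hne : f p.castSucc ≠ f p.succ := fun h => (Fin.castSucc_lt_succ (i := p)).ne (hf h)
  have hne' : g q.succ ≠ g q.castSucc := by rwa [← h1, ← h2]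
  have k1 := key f hf p
  have k2 := key g hg q
  rw [h1, h2] at a1 b1 k1
  by_cases c1 : x = g q.succ ∧ y = g q.castSucc
  · have d1 := a1 c1.1 c1.2
    have d2 := b2 c1.1 c1.2
    have d3 : ¬ [x, y].Sublist (List.ofFn (f ∘ adjSwap p)) := by
      rw [k1]
      rintro (h | h)
      · exact h.2 c1
      · exact hne' (c1.1.symm.trans h.1)
    have d4 : [x, y].Sublist (List.ofFn (g ∘ adjSwap q)) := k2.mpr (Or.inr c1)
    rw [if_neg d3, if_pos d4, if_pos d1, if_neg d2]
  · by_cases c2 : x = g q.castSucc ∧ y = g q.succ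
    · have d1 := a2 c2.1 c2.2
      have d2 := b1 c2.1 c2.2
      have d3 : ¬ [x, y].Sublist (List.ofFn (g ∘ adjSwap q)) := by
        rw [k2]
        rintro (h | h)
        · exact h.2 c2
        · exact hne' (h.1.symm.trans c2.1)
      have d4 : [x, y].Sublist (List.ofFn (f ∘ adjSwap p)) := k1.mpr (Or.inr c2)
      rw [if_pos d4, if_neg d3, if_neg d2, if_pos d1]
    · simp only [c1, c2, not_false_eq_true, and_true, or_false] at k1 k2
      simp only [k1, k2]

variable {G : Type*} [AddCommGroup G] [Fintype G] [DecidableEq G] {n : ℕ}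

/-- The translate by `i.2` of the base block number `i.1`. -/
def shiftBlock (Q : Fin n → Fin 4 → G) (i : Fin n × G) : Fin 4 → G := fun k => Q i.1 k + i.2

theorem shiftBlock_injective (Q : Fin n → Fin 4 → G) (hQ : ∀ j, Function.Injective (Q j))
    (i : Fin n × G) : Function.Injective (shiftBlock Q i) := by
  intro k l h
  exact hQ _ (add_right_cancel h)

/-- All blocks of the developed design. -/
def allBlocks (Q : Fin n → Fin 4 → G) : Multiset (List G) :=
  (Finset.univ : Finset (Fin n × G)).val.map (fun i => List.ofFn (shiftBlock Q i))

theorem allBlocks_count (Q : Fin n → Fin 4 → G) (hQ : ∀ j, Function.Injective (Q j))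
    (x y : G) (hxy : x ≠ y)
    (hd : ∀ d : G, d ≠ 0 → (Finset.univ.filter (fun m : Fin n × Fin 4 × Fin 4 =>
      m.2.1 < m.2.2 ∧ Q m.1 m.2.2 - Q m.1 m.2.1 = d)).card = 2) :
    (allBlocks Q).countP (fun b => [x, y].Sublist b) = 2 := by
  rw [← hd (y - x) (sub_ne_zero.mpr hxy.symm), allBlocks, Multiset.countP_map]
  change (Finset.univ.filter (fun i : Fin n × G =>
    [x, y].Sublist (List.ofFn (shiftBlock Q i)))).card = _
  symm
  refine Finset.card_bij (fun m _ => (m.1, x - Q m.1 m.2.1)) ?_ ?_ ?_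
  · rintro ⟨j, k, l⟩ hm
    simp only [Finset.mem_filter, Finset.mem_univ, true_and] at hm ⊢
    rw [pair_sublist_ofFn]
    refine ⟨k, l, hm.1, ?_, ?_⟩
    · simp [shiftBlock]
    · have h := hm.2
      simp only [shiftBlock]
      rw [← sub_add_cancel (Q j l) (Q j k), h]; abel
  · rintro ⟨j, k, l⟩ hm ⟨j', k', l'⟩ hm' h
    simp only [Finset.mem_filter, Finset.mem_univ, true_and, Prod.mk.injEq] at hm hm' h
    obtain ⟨rfl, h⟩ := h
    obtain rfl := hQ _ (sub_right_injective h)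
    have h3 : Q j l = Q j l' := by
      have := hm.2.trans hm'.2.symm
      exact sub_left_injective this
    rw [hQ _ h3]
  · rintro ⟨j, t⟩ hi
    simp only [Finset.mem_filter, Finset.mem_univ, true_and] at hi
    rw [pair_sublist_ofFn] at hi
    obtain ⟨k, l, hkl, rfl, rfl⟩ := hi
    refine ⟨(j, k, l), ?_, ?_⟩
    · simp [shiftBlock, hkl]
    · simp [shiftBlock]

/-- Duplicate check for a list of numbers; `acc` is the bit set of the values already seen. -/
def fastNodup : ℕ → List ℕ → Bool
  | _, [] => true
  | acc, c :: cs => !(Nat.testBit acc c) && fastNodup (acc ||| 1 <<< c) cs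

theorem fastNodup_sound (l : List ℕ) : ∀ acc : ℕ, fastNodup acc l = true →
    l.Nodup ∧ ∀ c ∈ l, acc.testBit c = false := by
  induction l with
  | nil => intro acc _; simp
  | cons c cs ih =>
    intro acc h
    simp only [fastNodup, Bool.and_eq_true, Bool.not_eq_true'] at h
    obtain ⟨h1, h2⟩ := ih _ h.2
    have h3 : ∀ d ∈ cs, acc.testBit d = false ∧ d ≠ c := by
      intro d hd
      have h4 := h2 d hd
      rw [Nat.testBit_or, Bool.or_eq_false_iff] at h4
      refine ⟨h4.1, ?_⟩
      rintro rfl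
      have h5 := h4.2
      rw [Nat.one_shiftLeft, Nat.testBit_two_pow_self] at h5
      exact absurd h5 (by decide)
    refine ⟨List.nodup_cons.mpr ⟨fun hc => (h3 c hc).2 rfl, h1⟩, ?_⟩
    intro d hd
    rcases List.mem_cons.mp hd with rfl | hd
    · exact h.1
    · exact (h3 d hd).1

/-- Ordered triples of distinct positions. -/
def triplePos : List (Fin 4 × Fin 4 × Fin 4) :=
  (List.finRange 4 ×ˢ (List.finRange 4 ×ˢ List.finRange 4)).filter
    (fun m => m.1 ≠ m.2.1 ∧ m.1 ≠ m.2.2 ∧ m.2.1 ≠ m.2.2)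

/-- Ordered triples of distinct positions in base blocks. -/
def tripleIdx (n : ℕ) : List (Fin n × Fin 4 × Fin 4 × Fin 4) :=
  List.finRange n ×ˢ triplePos

/-- A number depending only on the translation class of an ordered triple of a base block. -/
def tripleCode (Q : Fin n → Fin 4 → G) (φ : G → G → ℕ)
    (m : Fin n × Fin 4 × Fin 4 × Fin 4) : ℕ :=
  φ (Q m.1 m.2.2.1 - Q m.1 m.2.1) (Q m.1 m.2.2.2 - Q m.1 m.2.1)

theorem inter_card (Q : Fin n → Fin 4 → G)
    (φ : G → G → ℕ) (hs : fastNodup 0 ((tripleIdx n).map (tripleCode Q φ)) = true)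
    (i i' : Fin n × G) (hii : i ≠ i') :
    ((List.ofFn (shiftBlock Q i)).toFinset ∩ (List.ofFn (shiftBlock Q i')).toFinset).card ≤ 2 := by
  by_contra hcon
  rw [not_le, Finset.two_lt_card] at hcon
  obtain ⟨j, t⟩ := i
  obtain ⟨j', t'⟩ := i'
  obtain ⟨x, hx, y, hy, z, hz, hxy, hxz, hyz⟩ := hcon
  simp only [Finset.mem_inter, List.mem_toFinset, List.mem_ofFn, shiftBlock] at hx hy hz
  obtain ⟨⟨a, rfl⟩, ⟨a', ha⟩⟩ := hx
  obtain ⟨⟨b, rfl⟩, ⟨b', hb⟩⟩ := hy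
  obtain ⟨⟨c, rfl⟩, ⟨c', hc⟩⟩ := hz
  have hmem : ∀ (j : Fin n) (a b c : Fin 4), a ≠ b → a ≠ c → b ≠ c →
      (j, a, b, c) ∈ tripleIdx n := by
    intro j a b c h1 h2 h3
    simp [tripleIdx, triplePos, List.mem_filter, h1, h2, h3]
  have e1 : Q j b - Q j a = Q j' b' - Q j' a' := by
    rw [← add_sub_add_right_eq_sub (Q j b) (Q j a) t, ← ha, ← hb, add_sub_add_right_eq_sub]
  have e2 : Q j c - Q j a = Q j' c' - Q j' a' := by
    rw [← add_sub_add_right_eq_sub (Q j c) (Q j a) t, ← ha, ← hc, add_sub_add_right_eq_sub]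
  have hcode : tripleCode Q φ (j, a, b, c) = tripleCode Q φ (j', a', b', c') := by
    simp only [tripleCode, e1, e2]
  have m1 : (j, a, b, c) ∈ tripleIdx n := hmem _ _ _ _ (fun h => hxy (by rw [h]))
    (fun h => hxz (by rw [h])) (fun h => hyz (by rw [h]))
  have m2 : (j', a', b', c') ∈ tripleIdx n := by
    refine hmem _ _ _ _ (fun h => hxy ?_) (fun h => hxz ?_) (fun h => hyz ?_)
    · rw [← ha, ← hb, h]
    · rw [← ha, ← hc, h]
    · rw [← hb, ← hc, h]
  have heq := List.inj_on_of_nodup_map (fastNodup_sound _ _ hs).1 m1 m2 hcode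
  simp only [Prod.mk.injEq] at heq
  obtain ⟨rfl, rfl, -, -⟩ := heq
  exact hii (by rw [add_left_cancel ha])

theorem cyclic_main (Q : Fin n → Fin 4 → G) (π : Fin n → Fin n)
    (hQ : ∀ j, Function.Injective (Q j))
    (hd : ∀ d : G, d ≠ 0 → (Finset.univ.filter (fun m : Fin n × Fin 4 × Fin 4 =>
      m.2.1 < m.2.2 ∧ Q m.1 m.2.2 - Q m.1 m.2.1 = d)).card = 2)
    (φ : G → G → ℕ) (hs : fastNodup 0 ((tripleIdx n).map (tripleCode Q φ)) = true)
    (hπ : Function.Injective π)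
    (ht : ∀ j, ∃ p q : Fin 3, (Q j p.succ - Q j p.castSucc =
      Q (π j) q.castSucc - Q (π j) q.succ) ∧ (π j ≠ j ∨ Q j p.castSucc ≠ Q (π j) q.succ)) :
    ∃ D : DirectedDesign G 2 4 2, D.SuperSimple ∧ D.DefiningHalf := by
  have hcardB : ∀ i, (List.ofFn (shiftBlock Q i)).toFinset.card = 4 := by
    intro i
    rw [List.toFinset_card_of_nodup (List.nodup_ofFn.mpr (shiftBlock_injective Q hQ i))]
    simp
  have hinj : Function.Injective (fun i : Fin n × G => List.ofFn (shiftBlock Q i)) := by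
    intro i i' h
    by_contra hne
    have h1 := inter_card Q φ hs i i' hne
    simp only at h
    rw [← h, Finset.inter_self, hcardB] at h1
    omega
  have hnd : (allBlocks Q).Nodup := Finset.univ.nodup.map hinj
  have hmem : ∀ b, b ∈ allBlocks Q ↔ ∃ i, List.ofFn (shiftBlock Q i) = b := by
    intro b; simp [allBlocks]
  have hss : ∀ b₁ ∈ allBlocks Q, ∀ b₂ ∈ allBlocks Q, b₁ ≠ b₂ →
      (b₁.toFinset ∩ b₂.toFinset).card ≤ 2 := by
    intro b₁ h₁ b₂ h₂ hne
    obtain ⟨i, rfl⟩ := (hmem _).mp h₁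
    obtain ⟨i', rfl⟩ := (hmem _).mp h₂
    exact inter_card Q φ hs i i' (fun h => hne (by rw [h]))
  have hcov : ∀ s : List G, s.length = 2 → s.Nodup →
      (allBlocks Q).countP (fun b => s.Sublist b) = 2 := by
    intro s hl hn
    obtain ⟨x, y, rfl⟩ := List.length_eq_two.mp hl
    exact allBlocks_count Q hQ x y (by simpa using hn) hd
  refine ⟨⟨allBlocks Q, ?_, ?_, hcov⟩, ⟨hnd, hss⟩, ?_⟩
  · intro b hb
    obtain ⟨i, rfl⟩ := (hmem _).mp hb
    simp
  · intro b hb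
    obtain ⟨i, rfl⟩ := (hmem _).mp hb
    exact List.nodup_ofFn.mpr (shiftBlock_injective Q hQ i)
  rintro S ⟨hS, huniq⟩
  simp only at hS huniq ⊢
  choose p q hpq hne using ht
  set σ : Fin n × G → Fin n × G := fun i =>
    (π i.1, i.2 + (Q i.1 (p i.1).castSucc - Q (π i.1) (q i.1).succ)) with hσ
  have hσinj : Function.Injective σ := by
    rintro ⟨j, t⟩ ⟨j', t'⟩ h
    simp only [hσ, Prod.mk.injEq] at h
    obtain ⟨h1, h2⟩ := h
    obtain rfl := hπ h1
    rw [add_right_cancel h2]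
  -- each trade has to be met
  have hhit : ∀ i, List.ofFn (shiftBlock Q i) ∈ S ∨ List.ofFn (shiftBlock Q (σ i)) ∈ S := by
    intro i
    by_contra hcon
    push Not at hcon
    obtain ⟨hf, hg⟩ := hcon
    have hne' : σ i ≠ i := by
      intro h
      have e1 : π i.1 = i.1 := congrArg Prod.fst h
      have e2 := congrArg Prod.snd h
      simp only [hσ, add_eq_left, sub_eq_zero] at e2
      rcases hne i.1 with h' | h'
      · exact h' e1
      · exact h' e2
    have t1 : shiftBlock Q i (p i.1).castSucc = shiftBlock Q (σ i) (q i.1).succ := by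
      simp only [shiftBlock, hσ]; abel
    have t2 : shiftBlock Q i (p i.1).succ = shiftBlock Q (σ i) (q i.1).castSucc := by
      simp only [shiftBlock, hσ]
      have := hpq i.1
      rw [← sub_add_cancel (Q i.1 (p i.1).succ) (Q i.1 (p i.1).castSucc), this]; abel
    have tc := trade_count _ _ (shiftBlock_injective Q hQ i) (shiftBlock_injective Q hQ (σ i))
      (p i.1) (q i.1) t1 t2
    set f := shiftBlock Q i with hfdef
    set g := shiftBlock Q (σ i) with hgdef
    have hfm : List.ofFn f ∈ allBlocks Q := (hmem _).mpr ⟨i, rfl⟩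
    obtain ⟨R0, hR0⟩ := Multiset.exists_cons_of_mem hfm
    have hgm : List.ofFn g ∈ R0 := by
      have : List.ofFn g ∈ allBlocks Q := (hmem _).mpr ⟨σ i, rfl⟩
      rw [hR0, Multiset.mem_cons] at this
      rcases this with h | h
      · exact absurd (hinj h) hne'
      · exact h
    obtain ⟨R, rfl⟩ := Multiset.exists_cons_of_mem hgm
    have hfi := shiftBlock_injective Q hQ i
    have hgi := shiftBlock_injective Q hQ (σ i)
    have hbR : ∀ b ∈ R, b ∈ allBlocks Q := by
      intro b hb
      rw [hR0]; simp [hb]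
    let D' : DirectedDesign G 2 4 2 :=
      { blocks := List.ofFn (f ∘ adjSwap (p i.1)) ::ₘ List.ofFn (g ∘ adjSwap (q i.1)) ::ₘ R
        len := by
          intro b hb
          simp only [Multiset.mem_cons] at hb
          rcases hb with rfl | rfl | hb
          · simp
          · simp
          · obtain ⟨i, rfl⟩ := (hmem _).mp (hbR b hb)
            simp
        nodup := by
          intro b hb
          simp only [Multiset.mem_cons] at hb
          rcases hb with rfl | rfl | hb
          · exact List.nodup_ofFn.mpr (hfi.comp (Equiv.injective _))
          · exact List.nodup_ofFn.mpr (hgi.comp (Equiv.injective _))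
          · obtain ⟨i, rfl⟩ := (hmem _).mp (hbR b hb)
            exact List.nodup_ofFn.mpr (shiftBlock_injective Q hQ i)
        covers := by
          intro s hl hn
          rw [← hcov s hl hn, hR0]
          obtain ⟨x, y, rfl⟩ := List.length_eq_two.mp hl
          have := tc x y
          simp only [Multiset.countP_cons]
          omega }
    have hSD : S ≤ D'.blocks := by
      rw [hR0, Multiset.le_cons_of_notMem hf, Multiset.le_cons_of_notMem hg] at hS
      exact hS.trans ((Multiset.le_cons_self _ _).trans (Multiset.le_cons_self _ _))
    have heq := huniq D' hSD
    have hin : List.ofFn (f ∘ adjSwap (p i.1)) ∈ allBlocks Q := by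
      rw [← heq]; simp [D']
    have hneq : List.ofFn (f ∘ adjSwap (p i.1)) ≠ List.ofFn f := by
      intro h
      have h2 := congrFun (List.ofFn_injective h) (p i.1).castSucc
      have h3 := hfi h2
      simp only [adjSwap, Equiv.swap_apply_left] at h3
      exact (Fin.castSucc_lt_succ (i := p i.1)).ne h3.symm
    have h5 := hss _ hin _ hfm hneq
    have h6 : (List.ofFn (f ∘ adjSwap (p i.1))).toFinset = (List.ofFn f).toFinset := by
      ext x
      simp only [List.mem_toFinset, List.mem_ofFn, Function.comp]
      exact (adjSwap (p i.1)).surjective.exists (p := fun k => f k = x) |>.symm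
    rw [h6, Finset.inter_self, hcardB] at h5
    omega
  set T : Finset (Fin n × G) :=
    Finset.univ.filter (fun i => List.ofFn (shiftBlock Q i) ∈ S) with hT
  have hTS : T.card ≤ Multiset.card S := by
    have hle : T.val.map (fun i => List.ofFn (shiftBlock Q i)) ≤ S := by
      rw [Multiset.le_iff_subset (T.nodup.map hinj)]
      intro b hb
      obtain ⟨i, hi, rfl⟩ := Multiset.mem_map.mp hb
      exact (Finset.mem_filter.mp hi).2
    simpa using Multiset.card_le_card hle
  have hU : (Finset.univ : Finset (Fin n × G)) ⊆ T ∪ Finset.univ.filter (fun i => σ i ∈ T) := by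
    intro i _
    simpa [hT] using hhit i
  have h1 := (Finset.card_le_card hU).trans (Finset.card_union_le _ _)
  have h2 : (Finset.univ.filter (fun i => σ i ∈ T)).card ≤ T.card :=
    Finset.card_le_card_of_injOn σ (fun i hi => by simpa using hi) hσinj.injOn
  have h3 : Multiset.card (allBlocks Q) = (Finset.univ : Finset (Fin n × G)).card := by
    simp [allBlocks]
  omega

end CyclicConstruction

/-- The involution `0 ↔ 1, 2 ↔ 3, …`, fixing the last index if `n` is odd. -/
def pairUp (n : ℕ) (j : Fin n) : Fin n :=
  if j.val % 2 = 0 then (if h : j.val + 1 < n then ⟨j.val + 1, h⟩ else j)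
  else ⟨j.val - 1, lt_of_le_of_lt (Nat.sub_le _ _) j.isLt⟩

/-- Base blocks of a cyclic design on 37 points. -/
def baseBlocks37 : Fin 12 → Fin 4 → Fin 37 :=
  ![![36, 23, 0, 25],
    ![5, 16, 0, 12],
    ![0, 12, 9, 36],
    ![31, 15, 0, 25],
    ![32, 0, 18, 13],
    ![8, 0, 19, 17],
    ![20, 27, 0, 33],
    ![0, 4, 20, 3],
    ![9, 10, 0, 2],
    ![32, 9, 0, 35],
    ![6, 14, 0, 22],
    ![22, 0, 15, 19]]

set_option maxHeartbeats 4000000 in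
theorem exists_design_37 :
    ∃ D : DirectedDesign (Fin 37) 2 4 2, D.SuperSimple ∧ D.DefiningHalf :=
  cyclic_main baseBlocks37 (pairUp 12) (by decide +kernel) (by decide +kernel)
    (fun x y => x.val * 37 + y.val) (by decide +kernel) (by decide +kernel) (by decide +kernel)

/-- Base blocks of a cyclic design on 46 points. -/
def baseBlocks46 : Fin 15 → Fin 4 → Fin 46 :=
  ![![0, 43, 5, 38],
    ![15, 30, 0, 3],
    ![36, 0, 9, 43],
    ![5, 45, 0, 37],
    ![0, 32, 25, 31],
    ![0, 14, 10, 35],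
    ![0, 28, 42, 40],
    ![0, 18, 36, 20],
    ![10, 39, 0, 13],
    ![16, 24, 0, 33],
    ![0, 45, 23, 27],
    ![0, 1, 12, 17],
    ![0, 11, 26, 2],
    ![42, 22, 0, 35],
    ![17, 0, 23, 44]]

set_option maxHeartbeats 4000000 in
theorem exists_design_46 :
    ∃ D : DirectedDesign (Fin 46) 2 4 2, D.SuperSimple ∧ D.DefiningHalf :=
  cyclic_main baseBlocks46 (pairUp 15) (by decide +kernel) (by decide +kernel)
    (fun x y => x.val * 46 + y.val) (by decide +kernel) (by decide +kernel) (by decide +kernel)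

/-- Base blocks of a cyclic design on 52 points. -/
def baseBlocks52 : Fin 17 → Fin 4 → Fin 52 :=
  ![![11, 32, 0, 39],
    ![0, 13, 49, 8],
    ![35, 33, 0, 6],
    ![34, 12, 0, 46],
    ![9, 0, 18, 8],
    ![13, 19, 0, 34],
    ![8, 1, 0, 17],
    ![0, 35, 31, 5],
    ![0, 19, 46, 4],
    ![0, 33, 1, 36],
    ![5, 0, 49, 37],
    ![23, 45, 0, 3],
    ![51, 28, 0, 14],
    ![47, 22, 0, 38],
    ![29, 0, 41, 2],
    ![0, 11, 42, 4],
    ![0, 26, 28, 24]]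

set_option maxHeartbeats 4000000 in
theorem exists_design_52 :
    ∃ D : DirectedDesign (Fin 52) 2 4 2, D.SuperSimple ∧ D.DefiningHalf :=
  cyclic_main baseBlocks52 (pairUp 17) (by decide +kernel) (by decide +kernel)
    (fun x y => x.val * 52 + y.val) (by decide +kernel) (by decide +kernel) (by decide +kernel)

/-- Base blocks of a cyclic design on 76 points. -/
def baseBlocks76 : Fin 25 → Fin 4 → Fin 76 :=
  ![![14, 3, 0, 34],
    ![23, 49, 0, 42],
    ![53, 0, 44, 17],
    ![0, 32, 69, 75],
    ![73, 15, 0, 41],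
    ![72, 19, 0, 35],
    ![0, 39, 9, 66],
    ![0, 37, 47, 1],
    ![51, 0, 20, 38],
    ![43, 0, 56, 55],
    ![17, 0, 63, 32],
    ![0, 13, 5, 11],
    ![3, 0, 4, 54],
    ![0, 72, 25, 74],
    ![15, 71, 0, 17],
    ![6, 0, 59, 41],
    ![26, 48, 0, 8],
    ![0, 68, 43, 21],
    ![0, 64, 48, 3],
    ![0, 12, 67, 7],
    ![0, 11, 19, 71],
    ![0, 65, 10, 72],
    ![0, 42, 66, 14],
    ![0, 34, 28, 64],
    ![0, 38, 14, 47]]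

set_option maxHeartbeats 4000000 in
theorem exists_design_76 :
    ∃ D : DirectedDesign (Fin 76) 2 4 2, D.SuperSimple ∧ D.DefiningHalf :=
  cyclic_main baseBlocks76 (pairUp 25) (by decide +kernel) (by decide +kernel)
    (fun x y => x.val * 76 + y.val) (by decide +kernel) (by decide +kernel) (by decide +kernel)

/-- Base blocks of a cyclic design on 88 points. -/
def baseBlocks88 : Fin 29 → Fin 4 → Fin 88 :=
  ![![62, 77, 0, 28],
    ![9, 62, 0, 60],
    ![0, 54, 8, 59],
    ![33, 48, 0, 34],
    ![25, 0, 69, 34],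
    ![0, 19, 77, 37],
    ![25, 21, 0, 57],
    ![15, 18, 0, 31],
    ![55, 0, 19, 85],
    ![42, 0, 69, 41],
    ![23, 75, 0, 45],
    ![56, 84, 0, 43],
    ![0, 10, 41, 9],
    ![53, 0, 78, 47],
    ![0, 84, 8, 72],
    ![87, 65, 0, 4],
    ![0, 72, 39, 33],
    ![66, 0, 16, 40],
    ![11, 0, 17, 78],
    ![29, 74, 0, 71],
    ![52, 0, 14, 62],
    ![39, 68, 0, 74],
    ![0, 70, 68, 3],
    ![77, 45, 0, 18],
    ![0, 81, 83, 76],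
    ![0, 7, 80, 71],
    ![38, 76, 0, 68],
    ![13, 0, 20, 37],
    ![42, 67, 0, 44]]

set_option maxHeartbeats 4000000 in
theorem exists_design_88 :
    ∃ D : DirectedDesign (Fin 88) 2 4 2, D.SuperSimple ∧ D.DefiningHalf :=
  cyclic_main baseBlocks88 (pairUp 29) (by decide +kernel) (by decide +kernel)
    (fun x y => x.val * 88 + y.val) (by decide +kernel) (by decide +kernel) (by decide +kernel)

/-- For every `v` in the given set there exists a super-simple
`2-(v,4,2)` directed design in which every defining set contains at least
half of the blocks. -/
theorem exists_superSimple_DD_half_lemma11 (v : ℕ)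
    (hv : v ∈ ({37, 46, 52, 76, 88} : Finset ℕ)) :
    ∃ D : DirectedDesign (Fin v) 2 4 2, D.SuperSimple ∧ D.DefiningHalf := by
  simp only [Finset.mem_insert, Finset.mem_singleton] at hv
  rcases hv with rfl | rfl | rfl | rfl | rfl
  · exact exists_design_37
  · exact exists_design_46
  · exact exists_design_52
  · exact exists_design_76
  · exact exists_design_88
end

section
/- For every v ∈ {49, 61, 73, 97, 121} there exists a super-simple 2-(v,4,2) directed design whose every defining set contains at least half of the total number of blocks. -/
namespace DDHalf

/-- Number of occurrences of the ordered pair `(x, y)` in the block `(a, b, c, d)`. -/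
def pairCount {G : Type*} [DecidableEq G] (a b c d x y : G) : ℕ :=
  (if x = a ∧ y = b then 1 else 0) + (if x = a ∧ y = c then 1 else 0) +
  (if x = a ∧ y = d then 1 else 0) + (if x = b ∧ y = c then 1 else 0) +
  (if x = b ∧ y = d then 1 else 0) + (if x = c ∧ y = d then 1 else 0)

/-- Number of ordered differences of `(a, b, c, d)` equal to `e`. -/
def diffCount {G : Type*} [DecidableEq G] [Sub G] (a b c d e : G) : ℕ :=
  (if b - a = e then 1 else 0) + (if c - a = e then 1 else 0) +
  (if d - a = e then 1 else 0) + (if c - b = e then 1 else 0) +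
  (if d - b = e then 1 else 0) + (if d - c = e then 1 else 0)

lemma sublist_indicator {G : Type*} [DecidableEq G] (a b c d x y : G)
    (h : [a, b, c, d].Nodup) :
    (if [x, y].Sublist [a, b, c, d] then 1 else 0) = pairCount a b c d x y := by
  have key : [x, y].Sublist [a, b, c, d] ↔ (x = a ∧ y = b) ∨ (x = a ∧ y = c) ∨
      (x = a ∧ y = d) ∨ (x = b ∧ y = c) ∨ (x = b ∧ y = d) ∨ (x = c ∧ y = d) := by
    simp [List.sublist_cons_iff]
    grind
  simp only [key, pairCount]
  simp only [List.nodup_cons, List.mem_cons, not_or, List.not_mem_nil, not_false_eq_true] at h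
  grind

lemma sum_pairCount {G : Type*} [DecidableEq G] [AddCommGroup G] [Fintype G]
    (a b c d x y : G) :
    ∑ t : G, pairCount (a + t) (b + t) (c + t) (d + t) x y = diffCount a b c d (y - x) := by
  have one : ∀ p q : G, (∑ t : G, if x = p + t ∧ y = q + t then 1 else 0) =
      if q - p = y - x then 1 else 0 := by
    intro p q
    have : ∀ t : G, (x = p + t ∧ y = q + t) ↔ (t = x - p ∧ q - p = y - x) := by
      intro t
      constructor
      · rintro ⟨rfl, rfl⟩; constructor <;> abel
      · rintro ⟨rfl, h⟩
        refine ⟨by abel, ?_⟩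
        have : y = (y - x) + x := by abel
        rw [this, ← h]; abel
    simp only [this]
    by_cases h : q - p = y - x <;> simp [h]
  simp only [pairCount, diffCount, Finset.sum_add_distrib, one]

/-- A design all of whose blocks are paired into disjoint trades of volume two has
defining sets of size at least half of the number of blocks. -/
lemma half_of_trades {X ι : Type*} [DecidableEq X] [Fintype ι]
    (D : DirectedDesign X 2 4 2) (hD : D.SuperSimple) (f g f' g' : ι → List X)
    (hb : D.blocks = Finset.univ.val.map f + Finset.univ.val.map g)
    (hf : ∀ i, (f' i).Perm (f i)) (hg : ∀ i, (g' i).Perm (g i)) (hne : ∀ i, f' i ≠ f i)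
    (hc : ∀ i, ∀ x y, x ≠ y →
      (if [x, y].Sublist (f i) then 1 else 0) + (if [x, y].Sublist (g i) then 1 else 0) =
      (if [x, y].Sublist (f' i) then 1 else 0) + (if [x, y].Sublist (g' i) then 1 else 0)) :
    D.DefiningHalf := by
  classical
  have hnd := hD.1
  rw [hb, Multiset.nodup_add] at hnd
  obtain ⟨nf, ng, dj⟩ := hnd
  have injf : Function.Injective f := fun i j h =>
    Multiset.inj_on_of_nodup_map nf i (by simp) j (by simp) h
  have injg : Function.Injective g := fun i j h =>
    Multiset.inj_on_of_nodup_map ng i (by simp) j (by simp) h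
  have hfg : ∀ i j, f i ≠ g j := by
    intro i j h
    have h1 : f i ∈ Finset.univ.val.map f := by simp
    have h2 : f i ∈ Finset.univ.val.map g := by rw [h]; simp
    exact Multiset.disjoint_left.1 dj h1 h2
  intro S hS
  obtain ⟨hS1, hS2⟩ := hS
  have hit : ∀ i, f i ∈ S ∨ g i ∈ S := by
    intro i
    by_contra hcon
    push Not at hcon
    have hfi : f i ∈ D.blocks := by rw [hb]; simp
    have hgi : g i ∈ D.blocks := by rw [hb]; simp
    have hgi' : g i ∈ D.blocks.erase (f i) :=
      (Multiset.mem_erase_of_ne (hfg i i).symm).2 hgi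
    set R := (D.blocks.erase (f i)).erase (g i) with hR
    have hdec : D.blocks = f i ::ₘ g i ::ₘ R := by
      rw [hR, Multiset.cons_erase hgi', Multiset.cons_erase hfi]
    have hSR : S ≤ R := by
      rw [Multiset.le_iff_subset (Multiset.nodup_of_le hS1 hD.1)]
      intro b hbS
      have h1 := Multiset.mem_of_le hS1 hbS
      rw [hdec] at h1
      simp only [Multiset.mem_cons] at h1
      rcases h1 with h | h | h
      · exact absurd (h ▸ hbS) hcon.1
      · exact absurd (h ▸ hbS) hcon.2
      · exact h
    have hRm : ∀ b ∈ R, b ∈ D.blocks := by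
      intro b h; rw [hdec]; simp [h]
    let D' : DirectedDesign X 2 4 2 :=
      { blocks := f' i ::ₘ g' i ::ₘ R
        len := by
          intro b hbb
          simp only [Multiset.mem_cons] at hbb
          rcases hbb with h | h | h
          · rw [h, (hf i).length_eq]; exact D.len _ hfi
          · rw [h, (hg i).length_eq]; exact D.len _ hgi
          · exact D.len _ (hRm b h)
        nodup := by
          intro b hbb
          simp only [Multiset.mem_cons] at hbb
          rcases hbb with h | h | h
          · rw [h, (hf i).nodup_iff]; exact D.nodup _ hfi
          · rw [h, (hg i).nodup_iff]; exact D.nodup _ hgi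
          · exact D.nodup _ (hRm b h)
        covers := by
          intro s hs hsn
          have h0 := D.covers s hs hsn
          obtain ⟨x, y, rfl⟩ := List.length_eq_two.1 hs
          have hxy : x ≠ y := by simpa using hsn
          have := hc i x y hxy
          rw [hdec] at h0
          simp only [Multiset.countP_cons] at h0 ⊢
          omega }
    have hEq : f' i ::ₘ g' i ::ₘ R = D.blocks :=
      hS2 D' (hSR.trans ((Multiset.le_cons_self _ _).trans (Multiset.le_cons_self _ _)))
    have hm : f' i ∈ D.blocks := by rw [← hEq]; simp
    have h2 := hD.2 _ hm _ hfi (hne i)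
    rw [List.toFinset_eq_of_perm _ _ (hf i), Finset.inter_self,
      List.toFinset_card_of_nodup (D.nodup _ hfi), D.len _ hfi] at h2
    omega
  -- choose one block of `S` per trade
  let φ : ι → List X := fun i => if f i ∈ S then f i else g i
  have hφ : Function.Injective φ := by
    intro i j h
    simp only [φ] at h
    split_ifs at h
    · exact injf h
    · exact absurd h (hfg i j)
    · exact absurd h.symm (hfg j i)
    · exact injg h
  have hφS : Finset.univ.val.map φ ≤ S := by
    rw [Multiset.le_iff_subset (Finset.univ.nodup.map hφ)]
    intro b hb
    obtain ⟨i, -, rfl⟩ := Multiset.mem_map.1 hb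
    simp only [φ]
    split_ifs with h
    · exact h
    · exact (hit i).resolve_left h
  have := Multiset.card_le_card hφS
  rw [hb]
  simp only [Multiset.card_map, Multiset.card_add] at this ⊢
  omega

/-- Parameters `(d, p, q, r, s)` of a pair of base blocks. -/
abbrev Par (G : Type*) := G × G × G × G × G

/-- First base block `(0, d, p, q)`. -/
def blkA {G : Type*} [Zero G] : Par G → List G
  | (d, p, q, _, _) => [0, d, p, q]

/-- Second base block `(d, 0, r, s)`. -/
def blkB {G : Type*} [Zero G] : Par G → List G
  | (d, _, _, r, s) => [d, 0, r, s]

/-- Number of ordered differences equal to `e` in a pair of base blocks. -/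
def parCount {G : Type*} [DecidableEq G] [Zero G] [Sub G] (e : G) : Par G → ℕ
  | (d, p, q, r, s) => diffCount 0 d p q e + diffCount d 0 r s e

/-- All base blocks. -/
def bases {G : Type*} [Zero G] (L : List (Par G)) : List (List G) :=
  L.map blkA ++ L.map blkB

/-- The base blocks with an ordered choice of three points. -/
def flags {v : ℕ} [NeZero v] (BL : List (List (Fin v))) :
    List (List (Fin v) × Fin v × Fin v × Fin v) :=
  BL.flatMap fun b => b.flatMap fun x => b.flatMap fun y => b.flatMap fun z =>
    if x ≠ y ∧ (y - x).val < (z - x).val then [(b, x, y, z)] else []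

/-- Translation-invariant code of an ordered triple. -/
def code {v : ℕ} (w : List (Fin v) × Fin v × Fin v × Fin v) : ℕ :=
  (w.2.2.1 - w.2.1).val * v + (w.2.2.2 - w.2.1).val

lemma mem_flags {v : ℕ} [NeZero v] {BL : List (List (Fin v))} {b : List (Fin v)}
    {x y z : Fin v} (hb : b ∈ BL) (hx : x ∈ b) (hy : y ∈ b) (hz : z ∈ b) (hxy : x ≠ y)
    (h : (y - x).val < (z - x).val) : (b, x, y, z) ∈ flags BL := by
  simp only [flags, List.mem_flatMap]
  exact ⟨b, hb, x, hx, y, hy, z, hz, by simp [hxy, h]⟩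

lemma eq_of_code {v : ℕ} [NeZero v] {BL : List (List (Fin v))}
    (h : ((flags BL).map code).Nodup) {b b' : List (Fin v)} (hb : b ∈ BL) (hb' : b' ∈ BL)
    {t t' X Y Z : Fin v} (hXY : X ≠ Y) (hXZ : X ≠ Z) (hYZ : Y ≠ Z)
    (h1 : X ∈ b.map (· + t)) (h2 : Y ∈ b.map (· + t)) (h3 : Z ∈ b.map (· + t))
    (h1' : X ∈ b'.map (· + t')) (h2' : Y ∈ b'.map (· + t')) (h3' : Z ∈ b'.map (· + t')) :
    b = b' ∧ t = t' := by
  wlog hlt : (Y - X).val < (Z - X).val generalizing Y Z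
  · refine this hXZ hXY hYZ.symm h3 h2 h3' h2' ?_
    have : (Y - X).val ≠ (Z - X).val := by
      intro e
      exact hYZ (sub_left_injective (Fin.ext e))
    omega
  obtain ⟨x, hx, rfl⟩ := List.mem_map.1 h1
  obtain ⟨y, hy, rfl⟩ := List.mem_map.1 h2
  obtain ⟨z, hz, rfl⟩ := List.mem_map.1 h3
  obtain ⟨x', hx', ex⟩ := List.mem_map.1 h1'
  obtain ⟨y', hy', ey⟩ := List.mem_map.1 h2'
  obtain ⟨z', hz', ez⟩ := List.mem_map.1 h3'
  have e1 : y' - x' = y - x := by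
    rw [← add_sub_add_right_eq_sub y' x' t', ey, ex, add_sub_add_right_eq_sub]
  have e2 : z' - x' = z - x := by
    rw [← add_sub_add_right_eq_sub z' x' t', ez, ex, add_sub_add_right_eq_sub]
  have hlt' : (y - x).val < (z - x).val := by simpa using hlt
  have m := mem_flags hb hx hy hz (fun e => hXY (by rw [e])) hlt'
  have m' := mem_flags hb' hx' hy' hz' (by
    rintro rfl
    exact hXY (ex.symm.trans ey)) (by rw [e1, e2]; exact hlt')
  have := List.inj_on_of_nodup_map h m m' (by simp only [code, e1, e2])
  simp only [Prod.mk.injEq] at this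
  obtain ⟨rfl, rfl, -, -⟩ := this
  exact ⟨rfl, (add_left_cancel ex).symm⟩

lemma exists_triple {X : Type*} [DecidableEq X] {s : Finset X} (h : ¬ s.card ≤ 2) :
    ∃ x y z, x ∈ s ∧ y ∈ s ∧ z ∈ s ∧ x ≠ y ∧ x ≠ z ∧ y ≠ z :=
  by
    obtain ⟨x, y, z, hx, hy, hz, h⟩ := Finset.two_lt_card_iff.1 (not_le.1 h)
    exact ⟨x, y, z, hx, hy, hz, h⟩

/-- Difference-family construction. -/
theorem construct {v : ℕ} [NeZero v] (L : List (Par (Fin v)))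
    (hnd : ∀ b ∈ bases L, b.Nodup) (hB : (bases L).Nodup)
    (hdiff : ∀ e : Fin v, e ≠ 0 → (L.map (parCount e)).sum = 2)
    (hcode : ((flags (bases L)).map code).Nodup) :
    ∃ D : DirectedDesign (Fin v) 2 4 2, D.SuperSimple ∧ D.DefiningHalf := by
  let ι := Fin L.length × Fin v
  let f : ι → List (Fin v) := fun i => (blkA L[i.1]).map (· + i.2)
  let g : ι → List (Fin v) := fun i => (blkB L[i.1]).map (· + i.2)
  have memA : ∀ k : Fin L.length, blkA L[k] ∈ bases L := fun k =>
    List.mem_append_left _ (List.mem_map_of_mem (List.getElem_mem _))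
  have memB : ∀ k : Fin L.length, blkB L[k] ∈ bases L := fun k =>
    List.mem_append_right _ (List.mem_map_of_mem (List.getElem_mem _))
  have lenb : ∀ b ∈ bases L, b.length = 4 := by
    intro b hb
    rcases List.mem_append.1 hb with h | h <;> obtain ⟨T, -, rfl⟩ := List.mem_map.1 h <;> rfl
  have ndt : ∀ b ∈ bases L, ∀ t : Fin v, (b.map (· + t)).Nodup := fun b hb t =>
    (hnd b hb).map (add_left_injective t)
  let B : Multiset (List (Fin v)) := Finset.univ.val.map f + Finset.univ.val.map g
  have memB' : ∀ c ∈ B, ∃ b ∈ bases L, ∃ t, c = b.map (· + t) := by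
    intro c hc
    rcases Multiset.mem_add.1 hc with h | h <;> obtain ⟨i, -, rfl⟩ := Multiset.mem_map.1 h
    · exact ⟨_, memA i.1, i.2, rfl⟩
    · exact ⟨_, memB i.1, i.2, rfl⟩
  have sep : ∀ b ∈ bases L, ∀ b' ∈ bases L, ∀ t t' : Fin v,
      ¬ ((b.map (· + t)).toFinset ∩ (b'.map (· + t')).toFinset).card ≤ 2 → b = b' ∧ t = t' := by
    intro b hb b' hb' t t' h
    obtain ⟨x, y, z, hx, hy, hz, hxy, hxz, hyz⟩ := exists_triple h
    simp only [Finset.mem_inter, List.mem_toFinset] at hx hy hz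
    exact eq_of_code hcode hb hb' hxy hxz hyz hx.1 hy.1 hz.1 hx.2 hy.2 hz.2
  have sepEq : ∀ b ∈ bases L, ∀ b' ∈ bases L, ∀ t t' : Fin v,
      b.map (· + t) = b'.map (· + t') → b = b' ∧ t = t' := by
    intro b hb b' hb' t t' h
    apply sep b hb b' hb' t t'
    rw [← h, Finset.inter_self, List.toFinset_card_of_nodup (ndt b hb t), List.length_map,
      lenb b hb]
    omega
  obtain ⟨nA, nB, dAB⟩ := List.nodup_append.1 hB
  have injA : ∀ k l : Fin L.length, blkA L[k] = blkA L[l] → k = l := by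
    intro k l h
    have := (List.nodup_iff_injective_get.1 nA) (a₁ := ⟨k, by simp⟩) (a₂ := ⟨l, by simp⟩)
      (by simpa using h)
    simpa [Fin.ext_iff] using this
  have injB : ∀ k l : Fin L.length, blkB L[k] = blkB L[l] → k = l := by
    intro k l h
    have := (List.nodup_iff_injective_get.1 nB) (a₁ := ⟨k, by simp⟩) (a₂ := ⟨l, by simp⟩)
      (by simpa using h)
    simpa [Fin.ext_iff] using this
  have injf : Function.Injective f := by
    rintro ⟨k, t⟩ ⟨l, t'⟩ h
    obtain ⟨h1, rfl⟩ := sepEq _ (memA k) _ (memA l) t t' h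
    rw [injA k l h1]
  have injg : Function.Injective g := by
    rintro ⟨k, t⟩ ⟨l, t'⟩ h
    obtain ⟨h1, rfl⟩ := sepEq _ (memB k) _ (memB l) t t' h
    rw [injB k l h1]
  have ndB : B.Nodup := by
    rw [Multiset.nodup_add]
    refine ⟨Finset.univ.nodup.map injf, Finset.univ.nodup.map injg, ?_⟩
    rw [Multiset.disjoint_left]
    intro c h1 h2
    obtain ⟨⟨k, t⟩, -, rfl⟩ := Multiset.mem_map.1 h1
    obtain ⟨⟨l, t'⟩, -, h⟩ := Multiset.mem_map.1 h2
    obtain ⟨h1, -⟩ := sepEq _ (memB l) _ (memA k) t' t h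
    exact dAB _ (List.mem_map_of_mem (List.getElem_mem (l := L) k.2)) _
      (List.mem_map_of_mem (List.getElem_mem (l := L) l.2)) h1.symm
  have cnt : ∀ (F : ι → List (Fin v)) (x y : Fin v),
      (Finset.univ.val.map F).countP (fun b => [x, y].Sublist b) =
        ∑ k, ∑ t, if [x, y].Sublist (F (k, t)) then 1 else 0 := by
    intro F x y
    rw [Multiset.countP_map, ← Fintype.sum_prod_type (f := fun i : ι =>
      if [x, y].Sublist (F i) then 1 else 0), ← Finset.card_filter]
    rfl
  have cA : ∀ (k : Fin L.length) (x y : Fin v),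
      (∑ t, if [x, y].Sublist (f (k, t)) then 1 else 0) =
        diffCount 0 L[k].1 L[k].2.1 L[k].2.2.1 (y - x) := by
    intro k x y
    rw [← sum_pairCount]
    refine Finset.sum_congr rfl fun t _ => ?_
    exact sublist_indicator _ _ _ _ x y (ndt _ (memA k) t)
  have cB : ∀ (k : Fin L.length) (x y : Fin v),
      (∑ t, if [x, y].Sublist (g (k, t)) then 1 else 0) =
        diffCount L[k].1 0 L[k].2.2.2.1 L[k].2.2.2.2 (y - x) := by
    intro k x y
    rw [← sum_pairCount]
    refine Finset.sum_congr rfl fun t _ => ?_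
    exact sublist_indicator _ _ _ _ x y (ndt _ (memB k) t)
  let D : DirectedDesign (Fin v) 2 4 2 :=
    { blocks := B
      len := by
        intro c hc
        obtain ⟨b, hb, t, rfl⟩ := memB' c hc
        rw [List.length_map, lenb b hb]
      nodup := by
        intro c hc
        obtain ⟨b, hb, t, rfl⟩ := memB' c hc
        exact ndt b hb t
      covers := by
        intro s hs hsn
        obtain ⟨x, y, rfl⟩ := List.length_eq_two.1 hs
        have hxy : x ≠ y := by simpa using hsn
        have h0 := hdiff (y - x) (sub_ne_zero.2 hxy.symm)
        simp only [B, Multiset.countP_add, cnt, cA, cB]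
        rw [← Finset.sum_add_distrib, ← h0]
        exact Fin.sum_univ_fun_getElem L (parCount (y - x)) }
  have hSS : D.SuperSimple := by
    refine ⟨ndB, ?_⟩
    intro c hc c' hc' hne
    obtain ⟨b, hb, t, rfl⟩ := memB' c hc
    obtain ⟨b', hb', t', rfl⟩ := memB' c' hc'
    by_contra h
    obtain ⟨rfl, rfl⟩ := sep b hb b' hb' t t' h
    exact hne rfl
  refine ⟨D, hSS, ?_⟩
  refine half_of_trades D hSS f g
    (fun i => [L[i.1].1 + i.2, 0 + i.2, L[i.1].2.1 + i.2, L[i.1].2.2.1 + i.2])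
    (fun i => [0 + i.2, L[i.1].1 + i.2, L[i.1].2.2.2.1 + i.2, L[i.1].2.2.2.2 + i.2])
    rfl (fun i => List.Perm.swap _ _ _) (fun i => List.Perm.swap _ _ _) ?_ ?_
  · intro i h
    have h1 := ndt _ (memA i.1) i.2
    have h2 : L[i.1].1 + i.2 = 0 + i.2 := (List.cons.inj h).1
    have h3 : [0 + i.2, L[i.1].1 + i.2, L[i.1].2.1 + i.2, L[i.1].2.2.1 + i.2].Nodup := h1
    rw [h2] at h3
    simp at h3
  · intro i x y hxy
    have h1 : [0 + i.2, L[i.1].1 + i.2, L[i.1].2.1 + i.2, L[i.1].2.2.1 + i.2].Nodup :=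
      ndt _ (memA i.1) i.2
    have h2 : [L[i.1].1 + i.2, 0 + i.2, L[i.1].2.2.2.1 + i.2, L[i.1].2.2.2.2 + i.2].Nodup :=
      ndt _ (memB i.1) i.2
    have h1' := ((List.Perm.swap _ _ _).nodup_iff).1 h1
    have h2' := ((List.Perm.swap _ _ _).nodup_iff).1 h2
    rw [sublist_indicator _ _ _ _ x y h1', sublist_indicator _ _ _ _ x y h2']
    have e1 := sublist_indicator _ _ _ _ x y h1
    have e2 := sublist_indicator _ _ _ _ x y h2
    refine (congrArg₂ (· + ·) e1 e2).trans ?_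
    simp only [pairCount]
    omega

/-- Multiply all parameters by the elements of `H`. -/
def scale {v : ℕ} (H : List (Fin v)) (P : List (Par (Fin v))) : List (Par (Fin v)) :=
  H.flatMap fun h => P.map fun T =>
    (h * T.1, h * T.2.1, h * T.2.2.1, h * T.2.2.2.1, h * T.2.2.2.2)

/-- Base parameters for `v = 49`. -/
def L49 : List (Par (Fin 49)) := scale [1, 48]
  [(10, 33, 37, 48, 30), (21, 1, 27, 9, 14), (13, 16, 18, 43, 47), (17, 41, 3, 8, 42)]

/-- Base parameters for `v = 61`. -/
def L61 : List (Par (Fin 61)) := scale [1, 3, 9, 27, 20, 60, 58, 52, 34, 41]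
  [(39, 9, 37, 4, 58)]

/-- Base parameters for `v = 73`. -/
def L73 : List (Par (Fin 73)) := scale [1, 3, 9, 27, 8, 24, 72, 70, 64, 46, 65, 49]
  [(36, 39, 30, 31, 57)]

/-- Base parameters for `v = 97`. -/
def L97 : List (Par (Fin 97)) :=
  scale [1, 8, 64, 27, 22, 79, 50, 12, 96, 89, 33, 70, 75, 18, 47, 85]
  [(37, 45, 14, 85, 43)]

/-- Base parameters for `v = 121`. -/
def L121 : List (Par (Fin 121)) := scale [1, 40, 27, 112, 3, 120, 81, 94, 9, 118]
  [(77, 106, 2, 61, 24), (39, 95, 57, 118, 91)]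

/-- Fast kernel-friendly test that `a` does not occur in `l`. -/
def fresh (a : ℕ) (l : List ℕ) : Bool :=
  List.rec true (fun b _ r => bif Nat.beq a b then false else r) l

/-- Fast kernel-friendly duplicate-freeness test. -/
def nodupTest (l : List ℕ) : Bool :=
  List.rec true (fun a l r => bif fresh a l then r else false) l

lemma fresh_sound (a : ℕ) (l : List ℕ) (h : fresh a l = true) : a ∉ l := by
  induction l with
  | nil => simp
  | cons b l ih =>
    have h' : (bif Nat.beq a b then false else fresh a l) = true := h
    cases hab : Nat.beq a b with
    | true => simp [hab] at h'
    | false =>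
      rw [hab] at h'
      have := Nat.ne_of_beq_eq_false hab
      simp only [List.mem_cons, not_or]
      exact ⟨this, ih h'⟩

lemma nodupTest_sound (l : List ℕ) (h : nodupTest l = true) : l.Nodup := by
  induction l with
  | nil => simp
  | cons a l ih =>
    have h' : (bif fresh a l then nodupTest l else false) = true := h
    cases hal : fresh a l with
    | false => simp [hal] at h'
    | true =>
      rw [hal] at h'
      exact List.nodup_cons.2 ⟨fresh_sound a l hal, ih h'⟩

theorem nodups49 : ∀ b ∈ bases L49, b.Nodup := by decide +kernel

theorem distinct49 : (bases L49).Nodup := by decide +kernel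

theorem diffs49 : ∀ e : Fin 49, e ≠ 0 → (L49.map (parCount e)).sum = 2 := by
  decide +kernel

theorem codes49 : ((flags (bases L49)).map code).Nodup :=
  nodupTest_sound _ (by decide +kernel)

theorem nodups61 : ∀ b ∈ bases L61, b.Nodup := by decide +kernel

theorem distinct61 : (bases L61).Nodup := by decide +kernel

theorem diffs61 : ∀ e : Fin 61, e ≠ 0 → (L61.map (parCount e)).sum = 2 := by
  decide +kernel

theorem codes61 : ((flags (bases L61)).map code).Nodup :=
  nodupTest_sound _ (by decide +kernel)

theorem nodups73 : ∀ b ∈ bases L73, b.Nodup := by decide +kernel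

theorem distinct73 : (bases L73).Nodup := by decide +kernel

theorem diffs73 : ∀ e : Fin 73, e ≠ 0 → (L73.map (parCount e)).sum = 2 := by
  decide +kernel

theorem codes73 : ((flags (bases L73)).map code).Nodup :=
  nodupTest_sound _ (by decide +kernel)

theorem nodups97 : ∀ b ∈ bases L97, b.Nodup := by decide +kernel

theorem distinct97 : (bases L97).Nodup := by decide +kernel

theorem diffs97 : ∀ e : Fin 97, e ≠ 0 → (L97.map (parCount e)).sum = 2 := by
  decide +kernel

theorem codes97 : ((flags (bases L97)).map code).Nodup :=
  nodupTest_sound _ (by decide +kernel)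

theorem nodups121 : ∀ b ∈ bases L121, b.Nodup := by decide +kernel

theorem distinct121 : (bases L121).Nodup := by decide +kernel

theorem diffs121 : ∀ e : Fin 121, e ≠ 0 → (L121.map (parCount e)).sum = 2 := by
  decide +kernel

theorem codes121 : ((flags (bases L121)).map code).Nodup :=
  nodupTest_sound _ (by decide +kernel)

end DDHalf

/-- For every `v` in the given set there exists a super-simple
`2-(v,4,2)` directed design in which every defining set contains at least
half of the blocks. -/
theorem exists_superSimple_DD_half_lemma12 (v : ℕ)
    (hv : v ∈ ({49, 61, 73, 97, 121} : Finset ℕ)) :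
    ∃ D : DirectedDesign (Fin v) 2 4 2, D.SuperSimple ∧ D.DefiningHalf := by
  simp only [Finset.mem_insert, Finset.mem_singleton] at hv
  rcases hv with rfl | rfl | rfl | rfl | rfl
  · exact DDHalf.construct DDHalf.L49 DDHalf.nodups49 DDHalf.distinct49
      DDHalf.diffs49 DDHalf.codes49
  · exact DDHalf.construct DDHalf.L61 DDHalf.nodups61 DDHalf.distinct61
      DDHalf.diffs61 DDHalf.codes61
  · exact DDHalf.construct DDHalf.L73 DDHalf.nodups73 DDHalf.distinct73
      DDHalf.diffs73 DDHalf.codes73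
  · exact DDHalf.construct DDHalf.L97 DDHalf.nodups97 DDHalf.distinct97
      DDHalf.diffs97 DDHalf.codes97
  · exact DDHalf.construct DDHalf.L121 DDHalf.nodups121 DDHalf.distinct121
      DDHalf.diffs121 DDHalf.codes121
end

section
/- For every v ∈ {64, 100, 112} there exists a super-simple 2-(v,4,2) directed design whose every defining set contains at least half of the total number of blocks. -/
section CyclicConstruction

set_option linter.unusedSectionVars false

variable {X : Type*} [DecidableEq X]

/-- The list of ordered pairs occurring in a block. -/
def prs {X : Type*} : List X → List (X × X)
  | [] => []
  | a :: l => l.map (fun b => (a, b)) ++ prs l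

theorem mem_of_mem_prs {x y : X} : ∀ {l : List X}, (x, y) ∈ prs l → x ∈ l ∧ y ∈ l
  | [], h => by simp [prs] at h
  | a :: l, h => by
    simp only [prs, List.mem_append, List.mem_map, Prod.mk.injEq] at h
    rcases h with ⟨b, hb, rfl, rfl⟩ | h
    · simp [hb]
    · have := mem_of_mem_prs h
      simp [this.1, this.2]

theorem prs_map {Y : Type*} (f : X → Y) : ∀ l : List X,
    prs (l.map f) = (prs l).map (fun p => (f p.1, f p.2))
  | [] => rfl
  | a :: l => by
    simp only [List.map_cons, prs, List.map_append, prs_map f l, List.map_map]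
    rfl

theorem ite_sublist_eq_count (x y : X) : ∀ l : List X, l.Nodup →
    (if [x, y].Sublist l then 1 else 0) = (prs l).count (x, y)
  | [], _ => by simp [prs]
  | a :: l, h => by
    have ih := ite_sublist_eq_count x y l h.of_cons
    have ha : a ∉ l := (List.nodup_cons.1 h).1
    simp only [prs, List.count_append]
    by_cases hx : x = a
    · subst hx
      have h0 : (prs l).count (x, y) = 0 :=
        List.count_eq_zero.2 fun hm => ha (mem_of_mem_prs hm).1
      have h1 : (l.map (fun b => (x, b))).count (x, y) = l.count y :=
        List.count_map_of_injective l (fun b => (x, b)) (fun p q hpq => by simpa using hpq) y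
      rw [h0, h1, h.of_cons.count]
      simp only [List.cons_sublist_cons, List.singleton_sublist, add_zero]
    · have h1 : (l.map (fun b => (a, b))).count (x, y) = 0 :=
        List.count_eq_zero.2 (by simp; intro _ h; exact absurd h.symm hx)
      rw [h1, ← ih, zero_add]
      have : [x, y].Sublist (a :: l) ↔ [x, y].Sublist l := by
        constructor
        · intro hs
          cases hs with
          | cons _ h => exact h
          | cons_cons _ h => exact absurd rfl hx
        · exact fun h => h.cons _
      simp [this]

/-- Number of blocks containing `(x, y)` in order, via pair lists. -/
theorem countP_sublist_eq (x y : X) (M : Multiset (List X)) (hM : ∀ b ∈ M, b.Nodup) :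
    M.countP (fun b => [x, y].Sublist b) = (M.map (fun b => (prs b).count (x, y))).sum := by
  induction M using Multiset.induction_on with
  | empty => simp
  | cons b M ih =>
    rw [Multiset.countP_cons, Multiset.map_cons, Multiset.sum_cons,
      ih (fun c hc => hM c (Multiset.mem_cons_of_mem hc)),
      ← ite_sublist_eq_count x y b (hM b (Multiset.mem_cons_self b M)), add_comm]

variable [AddCommGroup X] [Fintype X]

theorem sum_count_translate (x y : X) : ∀ L : List (X × X),
    ∑ t : X, (L.map (fun p => (p.1 + t, p.2 + t))).count (x, y)
      = (L.map (fun p => p.2 - p.1)).count (y - x)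
  | [] => by simp
  | p :: L => by
    simp only [List.map_cons, List.count_cons, Finset.sum_add_distrib, sum_count_translate x y L]
    congr 1
    by_cases h : p.2 - p.1 = y - x
    · rw [Finset.sum_eq_single (x - p.1)]
      · have h2 : p.2 + (x - p.1) = y := by
          have : p.2 + (x - p.1) = (p.2 - p.1) + x := by abel
          rw [this, h]; abel
        simp [h, h2]
      · intro t _ ht
        have : p.1 + t ≠ x := fun hx => ht (by rw [← hx]; abel)
        simp [this]
      · simp
    · rw [Finset.sum_eq_zero]
      · simp [h]
      · intro t _
        have : ¬ (p.1 + t = x ∧ p.2 + t = y) := by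
          rintro ⟨rfl, rfl⟩
          exact h (by abel)
        simpa using this

/-- Translate of the `i`-th base block. -/
def trBlock (L : List (List X)) (q : X × Fin L.length) : List X :=
  L[q.2].map (· + q.1)

theorem sum_prs_count (L : List (List X)) (x y : X) :
    ∑ q : X × Fin L.length, (prs (trBlock L q)).count (x, y)
      = ((L.flatMap prs).map (fun p => p.2 - p.1)).count (y - x) := by
  rw [Fintype.sum_prod_type_right]
  rw [List.map_flatMap, List.count_flatMap, ← Fin.sum_univ_fun_getElem]
  refine Finset.sum_congr rfl fun i _ => ?_
  refine Eq.trans ?_ (sum_count_translate x y (prs L[i]))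
  refine Finset.sum_congr rfl fun t _ => ?_
  rw [trBlock, prs_map]

/-- The condition that distinct translates of base blocks meet in at most two points. -/
def SepCond (L : List (List X)) : Prop :=
  ∀ l ∈ L, ∀ l' ∈ L, ∀ a ∈ l, ∀ a' ∈ l', (l = l' ∧ a = a') ∨
    l.countP (fun z => decide (z - a + a' ∈ l')) ≤ 2

theorem eq_of_inter (L : List (List X)) (hL : L.Nodup) (hsep : SepCond L)
    (q r : X × Fin L.length)
    (h : 2 < ((trBlock L q).toFinset ∩ (trBlock L r).toFinset).card) : q = r := by
  obtain ⟨x, i⟩ := q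
  obtain ⟨y, j⟩ := r
  have hpos : 0 < ((trBlock L (x, i)).toFinset ∩ (trBlock L (y, j)).toFinset).card := by omega
  obtain ⟨p, hp⟩ := Finset.card_pos.1 hpos
  simp only [trBlock, Finset.mem_inter, List.mem_toFinset, List.mem_map] at hp
  obtain ⟨⟨a, ha, hax⟩, ⟨a', ha', hay⟩⟩ := hp
  have hxy : ∀ z : X, z - a + a' = z + x - y := by
    intro z
    have h1 : a = p - x := by rw [← hax]; abel
    have h2 : a' = p - y := by rw [← hay]; abel
    rw [h1, h2]; abel
  rcases hsep _ (List.getElem_mem i.2) _ (List.getElem_mem j.2) a ha a' ha' with h1 | h1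
  · have hij : i = j := Fin.ext ((hL.getElem_inj_iff).1 h1.1)
    have : x = y := by
      have := h1.2
      subst this
      exact add_left_cancel (hax.trans hay.symm)
    rw [hij, this]
  · exfalso
    have hle : ((trBlock L (x, i)).toFinset ∩ (trBlock L (y, j)).toFinset).card
        ≤ L[i].countP (fun z => decide (z - a + a' ∈ L[j])) := by
      have hsub : (trBlock L (x, i)).toFinset ∩ (trBlock L (y, j)).toFinset
          ⊆ ((L[i].filter (fun z => decide (z - a + a' ∈ L[j]))).map (· + x)).toFinset := by
        intro w hw
        simp only [trBlock, Finset.mem_inter, List.mem_toFinset, List.mem_map] at hw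
        obtain ⟨⟨z, hz, hzx⟩, ⟨z', hz', hzy⟩⟩ := hw
        simp only [List.mem_toFinset, List.mem_map, List.mem_filter, decide_eq_true_eq]
        refine ⟨z, ⟨hz, ?_⟩, hzx⟩
        have : z + x - y = z' := by rw [hzx, ← hzy]; abel
        rw [hxy, this]
        exact hz'
      refine (Finset.card_le_card hsub).trans ((List.toFinset_card_le _).trans ?_)
      rw [List.length_map, List.countP_eq_length_filter]
    exact absurd (h.trans_le hle) (not_lt.2 h1)

/-- A cyclic directed difference family with a trade pairing of its base blocks gives a
super-simple directed design all of whose defining sets are large. -/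
theorem exists_of_family (L : List (List X)) (L' : List (List X)) (hlen' : L'.length = L.length)
    (m : Fin L.length → Fin L.length) (s : Fin L.length → X)
    (hL : L.Nodup)
    (hlen : ∀ l ∈ L, l.length = 4) (hnd : ∀ l ∈ L, l.Nodup)
    (hlen2 : ∀ l ∈ L', l.length = 4) (hnd2 : ∀ l ∈ L', l.Nodup)
    (hcov : ∀ d : X, d ≠ 0 → ((L.flatMap prs).map (fun p => p.2 - p.1)).count d = 2)
    (hsep : SepCond L)
    (hm : ∀ i, m (m i) = i) (hs : ∀ i, s i + s (m i) = 0)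
    (hne : ∀ i, m i ≠ i ∨ s i ≠ 0)
    (htr : ∀ i : Fin L.length,
      (prs L[i] ++ prs (L[m i].map (· + s i))).Perm
        (prs L'[i] ++ prs (L'[m i].map (· + s i))))
    (hd1 : ∀ i : Fin L.length, L'[i] ≠ L[i])
    (hd2 : ∀ i : Fin L.length, L'[i] ≠ L[m i].map (· + s i)) :
    ∃ D : DirectedDesign X 2 4 2, D.SuperSimple ∧ D.DefiningHalf := by
  have htlen : ∀ q, (trBlock L q).length = 4 := fun q => by
    simp only [trBlock, List.length_map]
    exact hlen _ (List.getElem_mem q.2.2)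
  have htnd : ∀ q, (trBlock L q).Nodup := fun q =>
    (hnd _ (List.getElem_mem q.2.2)).map (add_left_injective q.1)
  have hinj : Function.Injective (trBlock L) := by
    intro q r hqr
    apply eq_of_inter L hL hsep
    rw [hqr, Finset.inter_self, List.toFinset_card_of_nodup (htnd r), htlen]
    norm_num
  let F : Finset (List X) := Finset.univ.map ⟨trBlock L, hinj⟩
  have hF : ∀ b, b ∈ F ↔ ∃ q, trBlock L q = b := fun b => by simp [F]
  have hFval : F.val = Finset.univ.val.map (trBlock L) := rfl
  have hFnd : ∀ b ∈ F.val, b.Nodup := by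
    intro b hb
    obtain ⟨q, rfl⟩ := (hF b).1 hb
    exact htnd q
  have hFlen : ∀ b ∈ F.val, b.length = 4 := by
    intro b hb
    obtain ⟨q, rfl⟩ := (hF b).1 hb
    exact htlen q
  have hFcov : ∀ s : List X, s.length = 2 → s.Nodup →
      F.val.countP (fun b => s.Sublist b) = 2 := by
    intro s hs hsn
    obtain ⟨x, y, rfl⟩ := List.length_eq_two.1 hs
    have hxy : x ≠ y := by simpa using hsn
    rw [countP_sublist_eq x y _ hFnd, hFval, Multiset.map_map]
    have := sum_prs_count L x y
    rw [hcov _ (sub_ne_zero.2 hxy.symm)] at this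
    exact this
  refine ⟨⟨F.val, hFlen, hFnd, hFcov⟩, ⟨F.nodup, ?_⟩, ?_⟩
  · intro b₁ h₁ b₂ h₂ hb
    obtain ⟨q, rfl⟩ := (hF b₁).1 h₁
    obtain ⟨r, rfl⟩ := (hF b₂).1 h₂
    by_contra hlt
    exact hb (congrArg _ (eq_of_inter L hL hsep q r (not_le.1 hlt)))
  · rintro S ⟨hS, huniq⟩
    change S ≤ F.val at hS
    change Multiset.card F.val ≤ _
    let σ : X × Fin L.length → X × Fin L.length := fun q => (q.1 + s q.2, m q.2)
    have hσ : ∀ q, σ (σ q) = q := by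
      rintro ⟨x, i⟩
      simp only [σ, hm, add_assoc, hs, add_zero]
    have hσne : ∀ q, σ q ≠ q := by
      rintro ⟨x, i⟩ h
      simp only [σ, Prod.mk.injEq, add_eq_left] at h
      rcases hne i with h' | h'
      · exact h' h.2
      · exact h' h.1
    have key : ∀ q, trBlock L q ∈ S ∨ trBlock L (σ q) ∈ S := by
      intro q
      by_contra hcon
      push Not at hcon
      obtain ⟨hq1, hq2⟩ := hcon
      obtain ⟨x, i⟩ := q
      set b := trBlock L (x, i) with hb
      set c := trBlock L (σ (x, i)) with hc
      have hbc : b ≠ c := fun h => hσne _ (hinj h).symm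
      have hbF : b ∈ F := (hF b).2 ⟨_, rfl⟩
      have hcF : c ∈ F := (hF c).2 ⟨_, rfl⟩
      have hSb : S ≤ (F.val.erase b).erase c := by
        rw [Multiset.le_iff_count]
        intro z
        have hz := Multiset.le_iff_count.1 hS z
        by_cases h1 : z = c
        · subst h1; rw [Multiset.count_eq_zero.2 hq2]; exact Nat.zero_le _
        · rw [Multiset.count_erase_of_ne h1]
          by_cases h2 : z = b
          · subst h2; rw [Multiset.count_eq_zero.2 hq1]; exact Nat.zero_le _
          · rwa [Multiset.count_erase_of_ne h2]
      obtain ⟨R, hR⟩ : ∃ R, R = (F.val.erase b).erase c := ⟨_, rfl⟩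
      have hFR : F.val = b ::ₘ c ::ₘ R := by
        rw [hR, Multiset.cons_erase, Multiset.cons_erase hbF]
        exact (Multiset.mem_erase_of_ne hbc.symm).2 hcF
      let b' : List X := L'[i].map (· + x)
      let c' : List X := L'[m i].map (· + (x + s i))
      have hcomp : ∀ l : List X, l.map (· + (x + s i)) = (l.map (· + s i)).map (· + x) := by
        intro l
        rw [List.map_map]
        refine List.map_congr_left fun z _ => ?_
        simp only [Function.comp]; abel
      have hi' : (i : ℕ) < L'.length := by rw [hlen']; exact i.2
      have hmi' : (m i : ℕ) < L'.length := by rw [hlen']; exact (m i).2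
      have hb'l : b'.length = 4 := by
        rw [List.length_map]; exact hlen2 _ (List.getElem_mem hi')
      have hc'l : c'.length = 4 := by
        rw [List.length_map]; exact hlen2 _ (List.getElem_mem hmi')
      have hb'n : b'.Nodup := (hnd2 _ (List.getElem_mem hi')).map (add_left_injective _)
      have hc'n : c'.Nodup := (hnd2 _ (List.getElem_mem hmi')).map (add_left_injective _)
      have hperm : (prs b ++ prs c).Perm (prs b' ++ prs c') := by
        have := (htr i).map (fun p => (p.1 + x, p.2 + x))
        rw [List.map_append, List.map_append, ← prs_map (· + x), ← prs_map (· + x),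
          ← prs_map (· + x), ← prs_map (· + x), ← hcomp, ← hcomp] at this
        exact this
      have hn' : ∀ z ∈ b' ::ₘ c' ::ₘ R, z.Nodup := by
        intro z hz
        rcases Multiset.mem_cons.1 hz with rfl | hz
        · exact hb'n
        rcases Multiset.mem_cons.1 hz with rfl | hz
        · exact hc'n
        · exact hFnd z (by rw [hFR]; simp [hz])
      have hl' : ∀ z ∈ b' ::ₘ c' ::ₘ R, z.length = 4 := by
        intro z hz
        rcases Multiset.mem_cons.1 hz with rfl | hz
        · exact hb'l
        rcases Multiset.mem_cons.1 hz with rfl | hz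
        · exact hc'l
        · exact hFlen z (by rw [hFR]; simp [hz])
      have hcov' : ∀ s : List X, s.length = 2 → s.Nodup →
          (b' ::ₘ c' ::ₘ R).countP (fun b => s.Sublist b) = 2 := by
        intro s hs hsn
        rw [← hFcov s hs hsn]
        obtain ⟨x, y, rfl⟩ := List.length_eq_two.1 hs
        rw [countP_sublist_eq x y _ hn', countP_sublist_eq x y _ hFnd, hFR]
        have := hperm.count_eq (x, y)
        rw [List.count_append, List.count_append] at this
        simp only [Multiset.map_cons, Multiset.sum_cons]
        omega
      have heq : b' ::ₘ c' ::ₘ R = F.val := by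
        refine huniq ⟨b' ::ₘ c' ::ₘ R, hl', hn', hcov'⟩ ?_
        change S ≤ b' ::ₘ c' ::ₘ R
        exact (hR ▸ hSb).trans ((Multiset.le_cons_self _ _).trans (Multiset.le_cons_self _ _))
      have hb'b : b' ≠ b := fun h =>
        hd1 i (List.map_injective_iff.2 (add_left_injective x) h)
      have hb'c : b' ≠ c := by
        intro h
        apply hd2 i
        apply List.map_injective_iff.2 (add_left_injective x)
        rw [← hcomp]
        exact h
      have hmem : Multiset.count b' (b' ::ₘ c' ::ₘ R) = Multiset.count b' F.val := by rw [heq]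
      rw [hFR, Multiset.count_cons_self, Multiset.count_cons_of_ne hb'b,
        Multiset.count_cons_of_ne hb'c, Multiset.count_cons] at hmem
      omega
    have hsub : (Finset.univ : Finset (X × Fin L.length)) ⊆
        Finset.univ.filter (fun q => trBlock L q ∈ S) ∪
          (Finset.univ.filter (fun q => trBlock L q ∈ S)).image σ := by
      intro q _
      rcases key q with h | h
      · exact Finset.mem_union_left _ (by simpa using h)
      · exact Finset.mem_union_right _ (Finset.mem_image.2 ⟨σ q, by simpa using h, hσ q⟩)
    have hcard : (Finset.univ.filter (fun q => trBlock L q ∈ S)).card ≤ Multiset.card S := by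
      rw [← Finset.card_map ⟨trBlock L, hinj⟩]
      apply Multiset.card_le_card
      rw [Multiset.le_iff_subset (Finset.nodup _)]
      intro z hz
      obtain ⟨q, hq, rfl⟩ := Finset.mem_map.1 hz
      exact (Finset.mem_filter.1 hq).2
    have h1 := Finset.card_le_card hsub
    have h2 := Finset.card_union_le (Finset.univ.filter (fun q => trBlock L q ∈ S))
      ((Finset.univ.filter (fun q => trBlock L q ∈ S)).image σ)
    have h3 := Finset.card_image_le (s := Finset.univ.filter (fun q => trBlock L q ∈ S)) (f := σ)
    have h4 : Multiset.card F.val = (Finset.univ : Finset (X × Fin L.length)).card := by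
      rw [hFval, Multiset.card_map]; rfl
    omega

end CyclicConstruction

section SepCheck

/-- Fast duplicate check for a list of natural numbers, with a bit mask of seen values. -/
def noDup : ℕ → List ℕ → Bool
  | _, [] => true
  | acc, n :: l => !acc.testBit n && noDup (acc ||| 2 ^ n) l

theorem nodup_of_noDup : ∀ (l : List ℕ) (acc : ℕ), noDup acc l = true →
    l.Nodup ∧ ∀ n ∈ l, acc.testBit n = false
  | [], _, _ => by simp
  | n :: l, acc, h => by
    simp only [noDup, Bool.and_eq_true, Bool.not_eq_true'] at h
    obtain ⟨h1, h2⟩ := nodup_of_noDup l _ h.2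
    have h3 : ∀ k ∈ l, acc.testBit k = false ∧ n ≠ k := by
      intro k hk
      have := h2 k hk
      simpa [Nat.testBit_or, Nat.testBit_two_pow] using this
    refine ⟨List.nodup_cons.2 ⟨fun hn => (h3 n hn).2 rfl, h1⟩, ?_⟩
    intro k hk
    rcases List.mem_cons.1 hk with rfl | hk
    · exact h.1
    · exact (h3 k hk).1

/-- All triples of distinct points in base blocks, together with the block. -/
def triples {X : Type*} [DecidableEq X] (L : List (List X)) : List (List X × X × X × X) :=
  L.flatMap fun l => l.flatMap fun a => l.flatMap fun b =>
    (l.filter (fun c => decide (a ≠ b ∧ a ≠ c ∧ b ≠ c))).map fun c => (l, a, b, c)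

theorem sepCond_of_noDup {X : Type*} [DecidableEq X] [AddCommGroup X]
    (L : List (List X)) (hnd : ∀ l ∈ L, l.Nodup) (κ : X → X → ℕ)
    (h : noDup 0 ((triples L).map (fun t => κ (t.2.2.1 - t.2.1) (t.2.2.2 - t.2.1))) = true) :
    SepCond L := by
  have hn := (nodup_of_noDup _ _ h).1
  have hmem : ∀ l ∈ L, ∀ a ∈ l, ∀ b ∈ l, ∀ c ∈ l, a ≠ b → a ≠ c → b ≠ c →
      (l, a, b, c) ∈ triples L := by
    intro l hl a ha b hb c hc h1 h2 h3
    simp only [triples, List.mem_flatMap, List.mem_map, List.mem_filter, decide_eq_true_eq]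
    exact ⟨l, hl, a, ha, b, hb, c, ⟨hc, h1, h2, h3⟩, rfl⟩
  intro l hl l' hl' a ha a' ha'
  by_contra hcon
  push Not at hcon
  obtain ⟨hc1, hc2⟩ := hcon
  rw [List.countP_eq_length_filter] at hc2
  have hfn := (hnd l hl).filter (fun z => decide (z - a + a' ∈ l'))
  rw [← List.toFinset_card_of_nodup hfn] at hc2
  have hle := Finset.pred_card_le_card_erase
    (s := (l.filter (fun z => decide (z - a + a' ∈ l'))).toFinset) (a := a)
  obtain ⟨b, hb, c, hc, hbc⟩ := Finset.one_lt_card.1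
    (show 1 < ((l.filter (fun z => decide (z - a + a' ∈ l'))).toFinset.erase a).card by omega)
  simp only [Finset.mem_erase, List.mem_toFinset, List.mem_filter, decide_eq_true_eq] at hb hc
  have t1 := hmem l hl a ha b hb.2.1 c hc.2.1 hb.1.symm hc.1.symm hbc
  have e1 : ∀ z, z - a + a' - a' = z - a := fun z => by abel
  have t2 := hmem l' hl' a' ha' _ hb.2.2 _ hc.2.2
    (fun e => hb.1 (by have := e1 b; rw [← e, sub_self] at this; exact (sub_eq_zero.1 this.symm)))
    (fun e => hc.1 (by have := e1 c; rw [← e, sub_self] at this; exact (sub_eq_zero.1 this.symm)))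
    (fun e => hbc (by simpa using e))
  have := List.inj_on_of_nodup_map hn t1 t2 (by simp only [e1])
  simp only [Prod.mk.injEq] at this
  exact hc1 this.1 this.2.1

end SepCheck

/-- The pairing `0 ↔ 0`, `1 ↔ 2`, `3 ↔ 4`, … of the base blocks. -/
def mate (k : ℕ) (i : Fin (2 * k + 1)) : Fin (2 * k + 1) :=
  if i = 0 then 0 else if i.val % 2 = 1 then i + 1 else i - 1

/-- Only the block number `0` is paired with a proper translate of itself. -/
def shift {X : Type*} [Zero X] (k : ℕ) (h : X) (i : Fin (2 * k + 1)) : X :=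
  if i = 0 then h else 0

/-- Base blocks of a cyclic directed design on 64 points. -/
def base64 : List (List (Fin 64)) :=
  [[55, 0, 32, 54], [49, 26, 0, 6], [19, 18, 6, 0], [52, 22, 0, 39], [39, 0, 15, 62],
   [0, 9, 47, 10], [16, 9, 0, 33], [59, 0, 31, 13], [8, 31, 0, 44], [0, 29, 35, 8],
   [29, 0, 49, 39], [8, 61, 0, 34], [34, 0, 29, 22], [0, 19, 14, 5], [22, 53, 19, 0],
   [0, 4, 7, 1], [43, 4, 0, 28], [0, 11, 43, 19], [48, 4, 11, 0], [14, 0, 16, 18],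
   [2, 16, 0, 28]]

/-- The base blocks of `base64` after interchanging the adjacent traded points. -/
def swap64 : List (List (Fin 64)) :=
  [[55, 32, 0, 54], [49, 26, 6, 0], [19, 18, 0, 6], [52, 22, 39, 0], [0, 39, 15, 62],
   [9, 0, 47, 10], [16, 0, 9, 33], [59, 31, 0, 13], [8, 0, 31, 44], [29, 0, 35, 8],
   [0, 29, 49, 39], [8, 61, 34, 0], [0, 34, 29, 22], [19, 0, 14, 5], [22, 53, 0, 19],
   [4, 0, 7, 1], [43, 0, 4, 28], [11, 0, 43, 19], [48, 4, 0, 11], [14, 16, 0, 18],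
   [2, 0, 16, 28]]

/-- Base blocks of a cyclic directed design on 100 points. -/
def base100 : List (List (Fin 100)) :=
  [[0, 50, 81, 49], [23, 60, 0, 70], [15, 88, 70, 0], [44, 0, 2, 60], [2, 0, 32, 25],
   [89, 20, 0, 28], [28, 0, 74, 19], [17, 96, 0, 5], [5, 0, 65, 29], [0, 14, 52, 7],
   [58, 14, 0, 21], [8, 20, 0, 71], [12, 71, 0, 39], [0, 13, 17, 66], [24, 18, 13, 0],
   [19, 4, 0, 38], [38, 0, 54, 41], [3, 47, 0, 11], [11, 0, 77, 90], [59, 16, 0, 99],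
   [64, 79, 99, 0], [10, 16, 0, 25], [25, 0, 61, 22], [0, 26, 17, 59], [26, 0, 18, 32],
   [27, 0, 28, 71], [63, 6, 28, 0], [0, 48, 5, 23], [52, 38, 48, 0], [0, 76, 26, 46],
   [22, 73, 76, 0], [0, 98, 33, 67], [53, 31, 98, 0]]

/-- The base blocks of `base100` after interchanging the adjacent traded points. -/
def swap100 : List (List (Fin 100)) :=
  [[50, 0, 81, 49], [23, 60, 70, 0], [15, 88, 0, 70], [44, 2, 0, 60], [0, 2, 32, 25],
   [89, 20, 28, 0], [0, 28, 74, 19], [17, 96, 5, 0], [0, 5, 65, 29], [14, 0, 52, 7],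
   [58, 0, 14, 21], [8, 20, 71, 0], [12, 0, 71, 39], [13, 0, 17, 66], [24, 18, 0, 13],
   [19, 4, 38, 0], [0, 38, 54, 41], [3, 47, 11, 0], [0, 11, 77, 90], [59, 16, 99, 0],
   [64, 79, 0, 99], [10, 16, 25, 0], [0, 25, 61, 22], [26, 0, 17, 59], [0, 26, 18, 32],
   [27, 28, 0, 71], [63, 6, 0, 28], [48, 0, 5, 23], [52, 38, 0, 48], [76, 0, 26, 46],
   [22, 73, 0, 76], [98, 0, 33, 67], [53, 31, 0, 98]]

/-- Base blocks of a cyclic directed design on 112 points. -/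
def base112 : List (List (Fin 112)) :=
  [[15, 0, 56, 96], [38, 0, 51, 69], [96, 51, 0, 30], [51, 0, 23, 87], [23, 0, 39, 34],
   [0, 65, 22, 99], [89, 17, 65, 0], [23, 0, 27, 111], [27, 0, 29, 54], [22, 59, 0, 15],
   [65, 15, 0, 101], [41, 7, 0, 82], [56, 88, 82, 0], [59, 19, 0, 77], [107, 77, 0, 3],
   [101, 57, 0, 38], [84, 48, 38, 0], [0, 83, 85, 51], [40, 83, 0, 50], [14, 0, 21, 12],
   [88, 21, 0, 1], [2, 0, 103, 8], [103, 0, 71, 35], [98, 8, 0, 52], [33, 52, 0, 42],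
   [58, 0, 73, 106], [73, 0, 55, 65], [95, 91, 0, 75], [79, 93, 75, 0], [29, 42, 0, 49],
   [109, 3, 49, 0], [3, 0, 45, 73], [45, 0, 107, 95], [0, 31, 43, 63], [53, 31, 0, 57],
   [26, 14, 0, 1], [53, 1, 0, 58]]

/-- The base blocks of `base112` after interchanging the adjacent traded points. -/
def swap112 : List (List (Fin 112)) :=
  [[15, 56, 0, 96], [38, 51, 0, 69], [96, 0, 51, 30], [51, 23, 0, 87], [0, 23, 39, 34],
   [65, 0, 22, 99], [89, 17, 0, 65], [23, 27, 0, 111], [0, 27, 29, 54], [22, 59, 15, 0],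
   [65, 0, 15, 101], [41, 7, 82, 0], [56, 88, 0, 82], [59, 19, 77, 0], [107, 0, 77, 3],
   [101, 57, 38, 0], [84, 48, 0, 38], [83, 0, 85, 51], [40, 0, 83, 50], [14, 21, 0, 12],
   [88, 0, 21, 1], [2, 103, 0, 8], [0, 103, 71, 35], [98, 8, 52, 0], [33, 0, 52, 42],
   [58, 73, 0, 106], [0, 73, 55, 65], [95, 91, 75, 0], [79, 93, 0, 75], [29, 42, 49, 0],
   [109, 3, 0, 49], [3, 45, 0, 73], [0, 45, 107, 95], [31, 0, 43, 63], [53, 0, 31, 57],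
   [26, 14, 1, 0], [53, 0, 1, 58]]

set_option maxHeartbeats 0 in
theorem exists_half_64 :
    ∃ D : DirectedDesign (Fin 64) 2 4 2, D.SuperSimple ∧ D.DefiningHalf := by
  have hnd : ∀ l ∈ base64, l.Nodup := by decide +kernel
  have hsep : SepCond base64 := sepCond_of_noDup _ hnd (fun x y => x.val * 64 + y.val)
    (by decide +kernel)
  have hm : ∀ i, mate 10 (mate 10 i) = i := by decide +kernel
  have hne : ∀ i, mate 10 i ≠ i ∨ shift 10 (32 : Fin 64) i ≠ 0 := by decide +kernel
  refine exists_of_family base64 swap64 (by decide +kernel) (mate 10) (shift 10 32)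
    ?_ ?_ hnd ?_ ?_ ?_ hsep hm ?_ hne ?_ ?_ ?_
  all_goals decide +kernel

set_option maxHeartbeats 0 in
theorem exists_half_100 :
    ∃ D : DirectedDesign (Fin 100) 2 4 2, D.SuperSimple ∧ D.DefiningHalf := by
  have hnd : ∀ l ∈ base100, l.Nodup := by decide +kernel
  have hsep : SepCond base100 := sepCond_of_noDup _ hnd (fun x y => x.val * 100 + y.val)
    (by decide +kernel)
  have hm : ∀ i, mate 16 (mate 16 i) = i := by decide +kernel
  have hne : ∀ i, mate 16 i ≠ i ∨ shift 16 (50 : Fin 100) i ≠ 0 := by decide +kernel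
  refine exists_of_family base100 swap100 (by decide +kernel) (mate 16) (shift 16 50)
    ?_ ?_ hnd ?_ ?_ ?_ hsep hm ?_ hne ?_ ?_ ?_
  all_goals decide +kernel

set_option maxHeartbeats 0 in
theorem exists_half_112 :
    ∃ D : DirectedDesign (Fin 112) 2 4 2, D.SuperSimple ∧ D.DefiningHalf := by
  have hnd : ∀ l ∈ base112, l.Nodup := by decide +kernel
  have hsep : SepCond base112 := sepCond_of_noDup _ hnd (fun x y => x.val * 112 + y.val)
    (by decide +kernel)
  have hm : ∀ i, mate 18 (mate 18 i) = i := by decide +kernel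
  have hne : ∀ i, mate 18 i ≠ i ∨ shift 18 (56 : Fin 112) i ≠ 0 := by decide +kernel
  refine exists_of_family base112 swap112 (by decide +kernel) (mate 18) (shift 18 56)
    ?_ ?_ hnd ?_ ?_ ?_ hsep hm ?_ hne ?_ ?_ ?_
  all_goals decide +kernel

/-- For every `v` in the given set there exists a super-simple
`2-(v,4,2)` directed design in which every defining set contains at least
half of the blocks. -/
theorem exists_superSimple_DD_half_lemma13 (v : ℕ)
    (hv : v ∈ ({64, 100, 112} : Finset ℕ)) :
    ∃ D : DirectedDesign (Fin v) 2 4 2, D.SuperSimple ∧ D.DefiningHalf := by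
  simp only [Finset.mem_insert, Finset.mem_singleton] at hv
  rcases hv with rfl | rfl | rfl
  · exact exists_half_64
  · exact exists_half_100
  · exact exists_half_112
end

section
/- For every v ∈ {70, 127} there exists a super-simple 2-(v,4,2) directed design whose every defining set contains at least half of the total number of blocks. -/
namespace L14

/-- Base block with natural number entries. -/
abbrev Blk := ℕ × ℕ × ℕ × ℕ

/-- The translate of a base block by `t`. -/
def tl {n : ℕ} (b : Blk) (t : ZMod n) : List (ZMod n) :=
  [(b.1 : ZMod n) + t, (b.2.1 : ZMod n) + t, (b.2.2.1 : ZMod n) + t, (b.2.2.2 : ZMod n) + t]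

/-- All blocks obtained by developing the base blocks. -/
def dev (n : ℕ) [NeZero n] (L : List Blk) : Multiset (List (ZMod n)) :=
  (L : Multiset Blk).bind fun b => (Finset.univ : Finset (ZMod n)).val.map (tl b)

/-- Subtraction modulo `n` on natural numbers. -/
def sb (n c a : ℕ) : ℕ := (c + (n - a)) % n

def ents (b : Blk) : List ℕ := [b.1, b.2.1, b.2.2.1, b.2.2.2]

def diffs (n : ℕ) (b : Blk) : List ℕ :=
  [sb n b.2.1 b.1, sb n b.2.2.1 b.1, sb n b.2.2.2 b.1,
   sb n b.2.2.1 b.2.1, sb n b.2.2.2 b.2.1, sb n b.2.2.2 b.2.2.1]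

def good (n : ℕ) (b : Blk) : Prop := (ents b).Nodup ∧ ∀ x ∈ ents b, x < n

instance (n : ℕ) (b : Blk) : Decidable (good n b) := by unfold good; infer_instance

def cross (n : ℕ) (b c : Blk) : List ℕ :=
  (ents b).flatMap fun x => (ents c).map fun y => sb n x y

def nrm (n : ℕ) (b : Blk) : Blk := (0, sb n b.2.1 b.1, sb n b.2.2.1 b.1, sb n b.2.2.2 b.1)

def edge (P Q : Blk) : Prop :=
  (Q.1 = P.2.1 ∧ Q.2.1 = P.1) ∨ (Q.2.2.1 = P.2.1 ∧ Q.2.2.2 = P.1)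

instance (P Q : Blk) : Decidable (edge P Q) := by unfold edge; infer_instance

theorem sb_cast {n c a : ℕ} (h : a < n) : ((sb n c a : ℕ) : ZMod n) = (c : ZMod n) - a := by
  unfold sb
  rw [ZMod.natCast_mod, Nat.cast_add, Nat.cast_sub h.le]
  simp [sub_eq_add_neg]

theorem sb_lt {n c a : ℕ} (h : a < n) : sb n c a < n := Nat.mod_lt _ (by omega)

theorem cast_inj {n a b : ℕ} (ha : a < n) (hb : b < n) : (a : ZMod n) = b ↔ a = b := by
  rw [ZMod.natCast_eq_natCast_iff']
  rw [Nat.mod_eq_of_lt ha, Nat.mod_eq_of_lt hb]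

theorem tl_length {n : ℕ} (b : Blk) (t : ZMod n) : (tl b t).length = 4 := rfl

theorem tl_nodup {n : ℕ} {b : Blk} (hb : good n b) (t : ZMod n) : (tl b t).Nodup := by
  obtain ⟨h1, h2⟩ := hb
  have : tl b t = (ents b).map (fun x : ℕ => (x : ZMod n) + t) := rfl
  rw [this]
  refine List.Nodup.map_on ?_ h1
  intro x hx y hy h
  exact (cast_inj (h2 x hx) (h2 y hy)).1 (add_right_cancel h)

theorem sub4 {X : Type*} {x y p q r s : X} :
    [x, y].Sublist [p, q, r, s] ↔ (x = p ∧ (y = q ∨ y = r ∨ y = s)) ∨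
      (x = q ∧ (y = r ∨ y = s)) ∨ (x = r ∧ y = s) := by
  simp only [List.cons_sublist_cons', List.sublist_nil]
  simp
  tauto

theorem sum6 {X : Type*} [DecidableEq X] {x y p q r s : X} (h : [p, q, r, s].Nodup) :
    (if [x, y].Sublist [p, q, r, s] then 1 else 0) =
    (if x = p ∧ y = q then 1 else 0) + (if x = p ∧ y = r then 1 else 0) +
    (if x = p ∧ y = s then 1 else 0) + (if x = q ∧ y = r then 1 else 0) +
    (if x = q ∧ y = s then 1 else 0) + (if x = r ∧ y = s then 1 else 0) := by
  simp only [sub4]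
  simp at h
  grind

theorem one_t {n : ℕ} [NeZero n] (a c x y : ZMod n) :
    (∑ t : ZMod n, if x = a + t ∧ y = c + t then 1 else 0) = if c - a = y - x then 1 else 0 := by
  have : ∀ t : ZMod n, (x = a + t ∧ y = c + t) ↔ (t = x - a ∧ c - a = y - x) := by
    intro t
    constructor
    · rintro ⟨rfl, rfl⟩; constructor <;> ring
    · rintro ⟨rfl, h⟩
      refine ⟨by ring, ?_⟩
      linear_combination -h
  simp only [this, ite_and]
  simp

theorem count_tl {n : ℕ} [NeZero n] {b : Blk} (hb : good n b) (x y : ZMod n) :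
    ((Finset.univ : Finset (ZMod n)).val.map (tl b)).countP (fun l => [x, y].Sublist l) =
      (diffs n b).count (y - x).val := by
  rw [Multiset.countP_map, ← Finset.filter_val, Finset.card_val, Finset.card_filter]
  refine (Finset.sum_congr rfl
    (fun t _ => sum6 (x := x) (y := y) (tl_nodup hb t))).trans ?_
  simp only [Finset.sum_add_distrib, one_t]
  have hl := hb.2
  simp only [ents, List.mem_cons, List.not_mem_nil, or_false, forall_eq_or_imp, forall_eq] at hl
  obtain ⟨l0, l1, l2, l3⟩ := hl
  have key : ∀ c a : ℕ, a < n → (((c : ZMod n) - a = y - x) ↔ (sb n c a = (y - x).val)) := by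
    intro c a ha
    rw [← sb_cast ha, ← cast_inj (sb_lt ha) (ZMod.val_lt _), ZMod.natCast_zmod_val]
  simp only [key _ _ l0, key _ _ l1, key _ _ l2, diffs, List.count_cons, List.count_nil,
    beq_iff_eq]
  ring

theorem count_dev {n : ℕ} [NeZero n] {L : List Blk} (hL : ∀ b ∈ L, good n b) (x y : ZMod n) :
    (dev n L).countP (fun l => [x, y].Sublist l) =
      (L.flatMap (diffs n)).count (y - x).val := by
  induction L with
  | nil => simp [dev]
  | cons b L ih =>
    have := ih (fun c hc => hL c (List.mem_cons_of_mem _ hc))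
    simp only [dev] at this ⊢
    rw [← Multiset.cons_coe, Multiset.cons_bind, Multiset.countP_add, this,
      count_tl (hL b List.mem_cons_self), List.flatMap_cons, List.count_append]

theorem mem_dev {n : ℕ} [NeZero n] {L : List Blk} {l : List (ZMod n)} :
    l ∈ dev n L ↔ ∃ b ∈ L, ∃ t, tl b t = l := by
  simp [dev]

theorem inter_le {n : ℕ} {b c : Blk} (hc : good n c) (t s : ZMod n)
    (h : (cross n b c).count (s - t).val ≤ 2) [NeZero n] :
    ((tl b t).toFinset ∩ (tl c s).toFinset).card ≤ 2 := by
  refine le_trans ?_ h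
  have e : (cross n b c).count (s - t).val =
      (((ents b) ×ˢ (ents c)).filter (fun p => sb n p.1 p.2 = (s - t).val)).length := by
    rw [← List.countP_eq_length_filter]
    have : cross n b c = ((ents b) ×ˢ (ents c)).map (fun p => sb n p.1 p.2) := by
      simp [cross, ents, List.product, SProd.sprod]
    rw [this, List.count, List.countP_map]
    rfl
  rw [e]
  have hsub : (tl b t).toFinset ∩ (tl c s).toFinset ⊆
      ((((ents b) ×ˢ (ents c)).filter (fun p => sb n p.1 p.2 = (s - t).val)).map
        (fun p => (p.1 : ZMod n) + t)).toFinset := by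
    intro z hz
    have e1 : tl b t = (ents b).map (fun x : ℕ => (x : ZMod n) + t) := rfl
    have e2 : tl c s = (ents c).map (fun x : ℕ => (x : ZMod n) + s) := rfl
    rw [e1, e2] at hz
    simp only [Finset.mem_inter, List.mem_toFinset, List.mem_map] at hz
    obtain ⟨⟨x, hx, rfl⟩, ⟨y, hy, hxy⟩⟩ := hz
    simp only [List.mem_toFinset, List.mem_map, List.mem_filter, decide_eq_true_eq]
    refine ⟨(x, y), ⟨List.pair_mem_product.2 ⟨hx, hy⟩, ?_⟩, rfl⟩
    have hyn := hc.2 y hy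
    rw [← cast_inj (sb_lt hyn) (ZMod.val_lt _), ZMod.natCast_zmod_val, sb_cast hyn]
    linear_combination -hxy
  refine (Finset.card_le_card hsub).trans ((List.toFinset_card_le _).trans ?_)
  simp

/-- `u` occurs at most `k` times in the list. -/
def atMost : ℕ → ℕ → List ℕ → Bool
  | _, _, [] => true
  | k, u, a :: l => bif Nat.beq a u then (match k with | 0 => false | k + 1 => atMost k u l)
      else atMost k u l

theorem atMost_le {k u : ℕ} {l : List ℕ} (h : atMost k u l = true) : l.count u ≤ k := by
  induction l generalizing k with
  | nil => simp
  | cons a l ih =>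
    rw [List.count_cons]
    by_cases hau : a = u
    · subst hau
      cases k with
      | zero => simp [atMost] at h
      | succ k =>
        simp only [atMost, Nat.beq_refl, cond_true] at h
        have := ih h
        simp
        omega
    · have hb : Nat.beq a u = false :=
        Bool.eq_false_iff.2 fun hh => hau (Nat.eq_of_beq_eq_true hh)
      simp only [atMost, hb, cond_false] at h
      have := ih h
      simp [hau]
      omega

/-- Every element except possibly `0` occurs at most twice (`z` allows the exception). -/
def twice (z : Bool) : List ℕ → Bool
  | [] => true
  | a :: l => (z && Nat.beq a 0 || atMost 1 a l) && twice z l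

theorem twice_le {z : Bool} {l : List ℕ} (h : twice z l = true) (u : ℕ)
    (hu : z = false ∨ u ≠ 0) : l.count u ≤ 2 := by
  induction l with
  | nil => simp
  | cons a l ih =>
    simp only [twice, Bool.and_eq_true, Bool.or_eq_true] at h
    rw [List.count_cons]
    by_cases hau : a = u
    · subst hau
      have h1 : atMost 1 a l = true := by
        rcases h.1 with ⟨hz, h0⟩ | h1
        · rcases hu with hu | hu
          · simp [hu] at hz
          · exact absurd (Nat.eq_of_beq_eq_true h0) hu
        · exact h1
      have := atMost_le h1
      simp
      omega
    · have := ih h.2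
      simp [hau]
      omega

/-- Cross condition. -/
def xc (n : ℕ) (b c : Blk) : Bool := twice false (cross n b c)

def sc (n : ℕ) (b : Blk) : Bool := twice true (cross n b b)

/-- Boolean pairwise test of the cross condition. -/
def allx (n : ℕ) : List Blk → Bool
  | [] => true
  | b :: L => L.all (xc n b) && allx n L

theorem allx_pairwise {n : ℕ} {L : List Blk} (h : allx n L = true) :
    L.Pairwise (fun b c => xc n b c = true) := by
  induction L with
  | nil => exact List.Pairwise.nil
  | cons b L ih =>
    simp only [allx, Bool.and_eq_true, List.all_eq_true] at h
    exact List.Pairwise.cons h.1 (ih h.2)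

theorem xc_all {n : ℕ} {b c : Blk} (h : xc n b c = true) (u : ℕ) :
    (cross n b c).count u ≤ 2 := twice_le h u (Or.inl rfl)

theorem sc_all {n : ℕ} {b : Blk} (h : sc n b = true) (u : ℕ) (h0 : u ≠ 0) :
    (cross n b b).count u ≤ 2 := twice_le h u (Or.inr h0)

theorem card_self {X : Type*} [DecidableEq X] {l : List X} (h : l.Nodup) :
    (l.toFinset ∩ l.toFinset).card = l.length := by
  rw [Finset.inter_self, List.toFinset_card_of_nodup h]

theorem self_le {n : ℕ} [NeZero n] {b : Blk} (hb : good n b) (h : sc n b = true) (t s : ZMod n)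
    (hts : t ≠ s) : ((tl b t).toFinset ∩ (tl b s).toFinset).card ≤ 2 := by
  refine inter_le hb t s (sc_all h _ ?_)
  rw [Ne, ZMod.val_eq_zero]
  exact fun e => hts (sub_eq_zero.1 e).symm

theorem dev_ss {n : ℕ} [NeZero n] {L : List Blk} (hL : ∀ b ∈ L, good n b)
    (hs : ∀ b ∈ L, sc n b = true) (hx : L.Pairwise (fun b c => xc n b c = true)) :
    (dev n L).Nodup ∧ ∀ b₁ ∈ dev n L, ∀ b₂ ∈ dev n L, b₁ ≠ b₂ →
      (b₁.toFinset ∩ b₂.toFinset).card ≤ 2 := by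
  have hP : L.Pairwise fun b c => ∀ t s : ZMod n,
      ((tl b t).toFinset ∩ (tl c s).toFinset).card ≤ 2 := by
    refine List.Pairwise.imp_of_mem ?_ hx
    intro b c _ hc h t s
    exact inter_le (hL c hc) t s (xc_all h _)
  constructor
  · unfold dev
    rw [Multiset.nodup_bind]
    constructor
    · intro b hb
      refine Multiset.Nodup.map_on ?_ Finset.univ.nodup
      intro t _ s _ h
      by_contra hts
      have := self_le (hL b hb) (hs b hb) t s hts
      rw [h, card_self (tl_nodup (hL b hb) s), tl_length] at this
      omega
    · refine ⟨L, rfl, ?_⟩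
      refine List.Pairwise.imp_of_mem ?_ hP
      intro b c hb hc h
      rw [Function.onFun, Multiset.disjoint_left]
      intro l hl hl'
      simp only [Multiset.mem_map] at hl hl'
      obtain ⟨t, _, rfl⟩ := hl
      obtain ⟨s, _, e⟩ := hl'
      have := h t s
      rw [e, card_self (tl_nodup (hL b hb) t), tl_length] at this
      omega
  · have hR : ∀ b ∈ L, ∀ c ∈ L, ∀ t s : ZMod n, tl b t ≠ tl c s →
        ((tl b t).toFinset ∩ (tl c s).toFinset).card ≤ 2 := by
      intro b hb c hc
      have : Std.Symm (fun b c : Blk => ∀ t s : ZMod n, tl b t ≠ tl c s →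
          ((tl b t).toFinset ∩ (tl c s).toFinset).card ≤ 2) := by
        constructor
        intro b c h t s hne
        rw [Finset.inter_comm]
        exact h s t hne.symm
      have := List.Pairwise.forall_of_forall (R := fun b c => ∀ t s : ZMod n, tl b t ≠ tl c s →
        ((tl b t).toFinset ∩ (tl c s).toFinset).card ≤ 2) (l := L) ?_ ?_
      · exact this hb hc
      · intro b hb t s hne
        exact self_le (hL b hb) (hs b hb) t s (fun e => hne (by rw [e]))
      · exact hP.imp (fun h t s _ => h t s)
    intro b₁ h₁ b₂ h₂ hne
    obtain ⟨b, hb, t, rfl⟩ := mem_dev.1 h₁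
    obtain ⟨c, hc, s, rfl⟩ := mem_dev.1 h₂
    exact hR b hb c hc t s hne

/-- Trade of volume two, common pair at the front of both blocks. -/
theorem trade1 {X : Type*} [DecidableEq X] {a b c d e f x y : X} (hP : [a, b, c, d].Nodup)
    (hQ : [b, a, e, f].Nodup) :
    (if [x, y].Sublist [a, b, c, d] then 1 else 0) +
      (if [x, y].Sublist [b, a, e, f] then 1 else 0) =
    (if [x, y].Sublist [b, a, c, d] then 1 else 0) +
      (if [x, y].Sublist [a, b, e, f] then 1 else 0) := by
  have hP' : [b, a, c, d].Nodup := by simp at hP ⊢; grind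
  have hQ' : [a, b, e, f].Nodup := by simp at hQ ⊢; grind
  rw [sum6 hP, sum6 hQ, sum6 hP', sum6 hQ']
  ring

theorem trade2 {X : Type*} [DecidableEq X] {a b c d e f x y : X} (hP : [a, b, c, d].Nodup)
    (hQ : [e, f, b, a].Nodup) :
    (if [x, y].Sublist [a, b, c, d] then 1 else 0) +
      (if [x, y].Sublist [e, f, b, a] then 1 else 0) =
    (if [x, y].Sublist [b, a, c, d] then 1 else 0) +
      (if [x, y].Sublist [e, f, a, b] then 1 else 0) := by
  have hP' : [b, a, c, d].Nodup := by simp at hP ⊢; grind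
  have hQ' : [e, f, a, b].Nodup := by simp at hQ ⊢; grind
  rw [sum6 hP, sum6 hQ, sum6 hP', sum6 hQ']
  ring

/-- A trade inside a super-simple design meets every defining set. -/
theorem hit {X : Type*} [DecidableEq X] (D : DirectedDesign X 2 4 2) (hD : D.SuperSimple)
    (S : Multiset (List X)) (hS : D.IsDefiningSet S) (P Q P' Q' : List X)
    (hP : P ∈ D.blocks) (hQ : Q ∈ D.blocks) (hPQ : P ≠ Q) (hPP : P ≠ P')
    (hp : P'.Perm P) (hq : Q'.Perm Q)
    (ht : ∀ x y : X, x ≠ y → (if [x, y].Sublist P then 1 else 0) +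
      (if [x, y].Sublist Q then 1 else 0) =
      (if [x, y].Sublist P' then 1 else 0) + (if [x, y].Sublist Q' then 1 else 0)) :
    P ∈ S ∨ Q ∈ S := by
  by_contra hcon
  rw [not_or] at hcon
  obtain ⟨hPS, hQS⟩ := hcon
  set R := (D.blocks.erase P).erase Q with hR
  have hQ2 : Q ∈ D.blocks.erase P := (Multiset.mem_erase_of_ne hPQ.symm).2 hQ
  have hB : D.blocks = P ::ₘ Q ::ₘ R := by
    rw [hR, Multiset.cons_erase hQ2, Multiset.cons_erase hP]
  have hSR : S ≤ R := by
    have h1 := Multiset.erase_le_erase P hS.1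
    rw [Multiset.erase_of_notMem hPS] at h1
    have h2 := Multiset.erase_le_erase Q h1
    rwa [Multiset.erase_of_notMem hQS] at h2
  have hRm : ∀ l ∈ R, l ∈ D.blocks := by
    intro l hl; rw [hB]; simp [hl]
  let D' : DirectedDesign X 2 4 2 :=
    { blocks := P' ::ₘ Q' ::ₘ R
      len := by
        intro l hl
        rw [Multiset.mem_cons, Multiset.mem_cons] at hl
        rcases hl with rfl | rfl | hl
        · rw [hp.length_eq]; exact D.len _ hP
        · rw [hq.length_eq]; exact D.len _ hQ
        · exact D.len _ (hRm l hl)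
      nodup := by
        intro l hl
        rw [Multiset.mem_cons, Multiset.mem_cons] at hl
        rcases hl with rfl | rfl | hl
        · exact hp.nodup_iff.2 (D.nodup _ hP)
        · exact hq.nodup_iff.2 (D.nodup _ hQ)
        · exact D.nodup _ (hRm l hl)
      covers := by
        intro s hs hn
        have h0 := D.covers s hs hn
        obtain ⟨x, y, rfl⟩ := List.length_eq_two.1 hs
        have hxy : x ≠ y := by simpa using hn
        have := ht x y hxy
        rw [hB] at h0
        simp only [Multiset.countP_cons] at h0 ⊢
        omega }
  have hE := hS.2 D' (hSR.trans ((Multiset.le_cons_self _ _).trans (Multiset.le_cons_self _ _)))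
  have hP'm : P' ∈ D.blocks := by
    rw [← hE]; exact Multiset.mem_cons_self _ _
  have hle := hD.2 P hP P' hP'm hPP
  rw [List.toFinset_eq_of_perm _ _ hp, card_self (D.nodup _ hP), D.len _ hP] at hle
  omega

theorem map_shift {n : ℕ} [NeZero n] {b : Blk} (hb : good n b) :
    (Finset.univ : Finset (ZMod n)).val.map (tl (nrm n b)) =
      (Finset.univ : Finset (ZMod n)).val.map (tl b) := by
  have hl := hb.2
  simp only [ents, List.mem_cons, List.not_mem_nil, or_false, forall_eq_or_imp, forall_eq] at hl
  obtain ⟨l0, l1, l2, l3⟩ := hl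
  have h1 : ∀ t : ZMod n, tl b t = tl (nrm n b) (Equiv.addRight (b.1 : ZMod n) t) := by
    intro t
    simp only [tl, nrm, sb_cast l0, Equiv.coe_addRight, Nat.cast_zero]
    congr 1
    · ring
    congr 1
    · ring
    congr 1
    · ring
    congr 1
    ring
  have h2 : (Finset.univ : Finset (ZMod n)).val.map (Equiv.addRight (b.1 : ZMod n)) =
      (Finset.univ : Finset (ZMod n)).val := by
    exact congrArg Finset.val (Finset.map_univ_equiv (Equiv.addRight (b.1 : ZMod n)))
  conv_lhs => rw [← h2]
  rw [Multiset.map_map]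
  refine Multiset.map_congr rfl ?_
  intro t _
  exact (h1 t).symm

theorem dev_nrm {n : ℕ} [NeZero n] {L : List Blk} (hL : ∀ b ∈ L, good n b) :
    dev n (L.map (nrm n)) = dev n L := by
  unfold dev
  rw [← Multiset.map_coe, Multiset.bind_map]
  refine Multiset.bind_congr ?_
  intro b hb
  exact map_shift (hL b hb)

theorem dev_perm {n : ℕ} [NeZero n] {L M : List Blk} (h : L.Perm M) : dev n L = dev n M := by
  unfold dev
  rw [Multiset.coe_eq_coe.2 h]

theorem half1 {α β : Type*} (p : β → Prop) [DecidablePred p] (f g : α → β) (m : Multiset α)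
    (h : ∀ t, p (f t) ∨ p (g t)) :
    Multiset.card (m.map f) ≤ (m.map f).countP p + (m.map g).countP p := by
  induction m using Multiset.induction with
  | empty => simp
  | cons a m ih =>
    rw [Multiset.map_cons, Multiset.map_cons, Multiset.card_cons, Multiset.countP_cons,
      Multiset.countP_cons]
    have : 1 ≤ (if p (f a) then 1 else 0) + (if p (g a) then 1 else 0) := by
      rcases h a with h | h <;> simp [h]
    omega

theorem half2 {n : ℕ} [NeZero n] (p : List (ZMod n) → Prop) [DecidablePred p]
    (L : List (Blk × Blk)) (h : ∀ e ∈ L, ∀ t : ZMod n, p (tl e.1 t) ∨ p (tl e.2 t)) :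
    Multiset.card (dev n (L.map Prod.fst)) ≤
      (dev n (L.map Prod.fst)).countP p + (dev n (L.map Prod.snd)).countP p := by
  induction L with
  | nil => simp [dev]
  | cons e L ih =>
    have h1 := ih (fun c hc => h c (List.mem_cons_of_mem _ hc))
    have h2 := half1 p (tl e.1) (tl e.2) (Finset.univ : Finset (ZMod n)).val
      (h e List.mem_cons_self)
    simp only [dev, List.map_cons] at h1 ⊢
    rw [← Multiset.cons_coe, Multiset.cons_bind, ← Multiset.cons_coe, Multiset.cons_bind,
      Multiset.card_add, Multiset.countP_add, Multiset.countP_add]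
    omega

theorem main {n : ℕ} [NeZero n] (L : List (Blk × Blk))
    (hg1 : ∀ b ∈ L.map Prod.fst, good n b) (hg2 : ∀ b ∈ L.map Prod.snd, good n b)
    (hc : ∀ d ∈ List.range n, d = 0 ∨ ((L.map Prod.fst).flatMap (diffs n)).count d = 2)
    (hs : (L.map Prod.fst).all (sc n) = true) (hx : allx n (L.map Prod.fst) = true)
    (he : ∀ e ∈ L, edge e.1 e.2)
    (hp : ((L.map Prod.snd).map (nrm n)).Perm ((L.map Prod.fst).map (nrm n))) :
    ∃ D : DirectedDesign (ZMod n) 2 4 2, D.SuperSimple ∧ D.DefiningHalf := by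
  let D : DirectedDesign (ZMod n) 2 4 2 :=
    { blocks := dev n (L.map Prod.fst)
      len := by
        intro l hl
        obtain ⟨b, _, t, rfl⟩ := mem_dev.1 hl
        rfl
      nodup := by
        intro l hl
        obtain ⟨b, hb, t, rfl⟩ := mem_dev.1 hl
        exact tl_nodup (hg1 b hb) t
      covers := by
        intro s hs hn
        obtain ⟨x, y, rfl⟩ := List.length_eq_two.1 hs
        have hxy : x ≠ y := by simpa using hn
        rw [count_dev hg1]
        refine (hc _ (List.mem_range.2 (ZMod.val_lt _))).resolve_left ?_
        rw [ZMod.val_eq_zero]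
        exact fun e => hxy (sub_eq_zero.1 e).symm }
  have hss : D.SuperSimple := dev_ss hg1 (List.all_eq_true.1 hs) (allx_pairwise hx)
  have hdev : dev n (L.map Prod.snd) = dev n (L.map Prod.fst) := by
    rw [← dev_nrm hg2, ← dev_nrm hg1]
    exact dev_perm hp
  refine ⟨D, hss, ?_⟩
  intro S hS
  have hhit : ∀ e ∈ L, ∀ t : ZMod n, tl e.1 t ∈ S ∨ tl e.2 t ∈ S := by
    intro e heL t
    have m1 : e.1 ∈ L.map Prod.fst := List.mem_map_of_mem heL
    have m2 : e.2 ∈ L.map Prod.snd := List.mem_map_of_mem heL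
    have d1 : tl e.1 t ∈ D.blocks := mem_dev.2 ⟨_, m1, t, rfl⟩
    have d2 : tl e.2 t ∈ D.blocks := by
      change _ ∈ dev n (L.map Prod.fst)
      rw [← hdev]
      exact mem_dev.2 ⟨_, m2, t, rfl⟩
    have n1 := tl_nodup (hg1 _ m1) t
    have n2 := tl_nodup (hg2 _ m2) t
    have hed := he e heL
    obtain ⟨⟨a, b, c, d⟩, ⟨a', b', c', d'⟩⟩ := e
    simp only [edge] at hed
    simp only [tl] at d1 d2 n1 n2 ⊢
    rcases hed with ⟨rfl, rfl⟩ | ⟨rfl, rfl⟩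
    · refine hit D hss S hS _ _ _ _ d1 d2 ?_ ?_ (List.Perm.swap _ _ _) (List.Perm.swap _ _ _)
        (fun x y _ => trade1 n1 n2)
      · intro h
        simp at h n1
        tauto
      · intro h
        simp at h n1
        tauto
    · refine hit D hss S hS _ _ _ _ d1 d2 ?_ ?_ (List.Perm.swap _ _ _)
        (((List.Perm.swap _ _ _).cons _).cons _) (fun x y _ => trade2 n1 n2)
      · intro h
        simp at h n1
        tauto
      · intro h
        simp at h n1
        tauto
  have h2 := half2 (n := n) (· ∈ S) L hhit
  rw [hdev] at h2
  have h3 : (dev n (L.map Prod.fst)).countP (· ∈ S) ≤ Multiset.card S := by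
    rw [Multiset.countP_eq_card_filter]
    refine Multiset.card_le_card ((Multiset.le_iff_subset (hss.1.filter _)).2 ?_)
    intro l hl
    exact (Multiset.mem_filter.1 hl).2
  change Multiset.card (dev n (L.map Prod.fst)) ≤ _
  omega

/-- Representatives modulo negation of the multiplier subgroup of order 42 modulo 127
(the nonzero cubes). -/
def H127 : List ℕ := [1, 2, 4, 5, 8, 10, 16, 19, 20, 25, 27, 32, 33, 38, 40, 47, 50, 51, 54, 61, 63]

def P127 : List (Blk × Blk) := H127.map fun h =>
  ((0, h, 3 * h % 127, 12 * h % 127),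
    (h, 0, sb 127 h (3 * h % 127), sb 127 h (12 * h % 127)))

def L127 : List (Blk × Blk) := P127 ++ P127.map Prod.swap

theorem perm_swap (P : List (Blk × Blk)) :
    ((P ++ P.map Prod.swap).map Prod.snd).Perm ((P ++ P.map Prod.swap).map Prod.fst) := by
  have h1 : (P.map Prod.swap).map Prod.snd = P.map Prod.fst := by
    rw [List.map_map]; rfl
  have h2 : (P.map Prod.swap).map Prod.fst = P.map Prod.snd := by
    rw [List.map_map]; rfl
  rw [List.map_append, List.map_append, h1, h2]
  exact List.perm_append_comm

theorem ex127 : ∃ D : DirectedDesign (ZMod 127) 2 4 2, D.SuperSimple ∧ D.DefiningHalf := by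
  refine main L127 ?_ ?_ ?_ ?_ ?_ ?_ ((perm_swap P127).map _) <;> decide +kernel

/-- Eleven pairs of base blocks modulo 70, each pair forming a trade. -/
def P70 : List (Blk × Blk) :=
  [((0, 50, 25, 10), (50, 0, 68, 11)),
   ((38, 59, 48, 50), (59, 38, 34, 4)),
   ((0, 26, 50, 37), (26, 0, 20, 8)),
   ((29, 32, 57, 21), (32, 29, 38, 1)),
   ((59, 58, 40, 42), (58, 59, 7, 5)),
   ((67, 58, 51, 19), (58, 67, 4, 36)),
   ((56, 5, 9, 22), (5, 56, 52, 39)),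
   ((52, 37, 58, 15), (37, 52, 31, 4)),
   ((49, 54, 25, 57), (54, 49, 8, 46)),
   ((25, 55, 11, 54), (55, 25, 69, 26)),
   ((48, 55, 20, 43), (55, 48, 13, 60))]

def L70 : List (Blk × Blk) :=
  ((0, 56, 46, 60), (10, 66, 56, 0)) :: (P70 ++ P70.map Prod.swap)

theorem ex70 : ∃ D : DirectedDesign (ZMod 70) 2 4 2, D.SuperSimple ∧ D.DefiningHalf := by
  have h : nrm 70 (10, 66, 56, 0) = nrm 70 (0, 56, 46, 60) := by decide
  have hp : ((L70.map Prod.snd).map (nrm 70)).Perm ((L70.map Prod.fst).map (nrm 70)) := by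
    simp only [L70, List.map_cons]
    rw [h]
    exact ((perm_swap P70).map (nrm 70)).cons _
  refine main L70 ?_ ?_ ?_ ?_ ?_ ?_ hp <;> decide +kernel

end L14

/-- For every `v` in the given set there exists a super-simple
`2-(v,4,2)` directed design in which every defining set contains at least
half of the blocks. -/
theorem exists_superSimple_DD_half_lemma14 (v : ℕ)
    (hv : v ∈ ({70, 127} : Finset ℕ)) :
    ∃ D : DirectedDesign (Fin v) 2 4 2, D.SuperSimple ∧ D.DefiningHalf := by
  simp only [Finset.mem_insert, Finset.mem_singleton] at hv
  rcases hv with rfl | rfl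
  · exact L14.ex70
  · exact L14.ex127
end

section
/- For every v ∈ {55, 82, 85, 106, 109, 118} there exists a super-simple 2-(v,4,2) directed design whose every defining set contains at least half of the total number of blocks. -/
namespace Lemma15

set_option linter.unusedSimpArgs false
set_option linter.unusedSectionVars false

/-! ### Defining sets and disjoint trades of volume two -/

lemma sub4 {Y : Type*} [DecidableEq Y] (x y a b c d : Y) :
    [x, y].Sublist [a, b, c, d] ↔
      (a = x ∧ b = y) ∨ (a = x ∧ c = y) ∨ (a = x ∧ d = y) ∨
      (b = x ∧ c = y) ∨ (b = x ∧ d = y) ∨ (c = x ∧ d = y) := by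
  simp [List.sublist_cons_iff]
  grind

lemma ind4 {Y : Type*} [DecidableEq Y] (x y a b c d : Y) (h : [a, b, c, d].Nodup) :
    (if [x, y].Sublist [a, b, c, d] then 1 else 0 : ℕ) =
      (if a = x ∧ b = y then 1 else 0) + (if a = x ∧ c = y then 1 else 0) +
      (if a = x ∧ d = y then 1 else 0) + (if b = x ∧ c = y then 1 else 0) +
      (if b = x ∧ d = y then 1 else 0) + (if c = x ∧ d = y then 1 else 0) := by
  simp only [sub4]
  simp only [List.nodup_cons, List.mem_cons, List.not_mem_nil, or_false, not_or] at h
  obtain ⟨⟨h1, h2, h3⟩, ⟨h4, h5⟩, h6, -⟩ := h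
  by_cases ha : a = x
  · subst ha
    by_cases hb : b = y
    · subst hb; simp [h1, h2, h3, h4, h5, h6, Ne.symm h1, Ne.symm h2, Ne.symm h3, Ne.symm h4,
        Ne.symm h5, Ne.symm h6]
    · by_cases hc : c = y
      · subst hc; simp [hb, h1, h2, h3, h4, h5, h6, Ne.symm h1, Ne.symm h2, Ne.symm h3,
          Ne.symm h4, Ne.symm h5, Ne.symm h6]
      · simp [hb, hc, Ne.symm h1, Ne.symm h2, Ne.symm h3]
  · by_cases hb : b = x
    · subst hb
      by_cases hc : c = y
      · subst hc; simp [ha, h4, h5, h6, Ne.symm h4, Ne.symm h5, Ne.symm h6]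
      · simp [ha, hc, Ne.symm h4]
    · simp [ha, hb]

lemma half {Y : Type*} [DecidableEq Y] {ι : Type*} (J : Finset ι)
    (b₁ b₂ c₁ c₂ : ι → List Y) (D : DirectedDesign Y 2 4 2)
    (hD : D.blocks = J.val.map b₁ + J.val.map b₂) (hnd : D.blocks.Nodup)
    (hl₁ : ∀ j ∈ J, (c₁ j).length = 4) (hl₂ : ∀ j ∈ J, (c₂ j).length = 4)
    (hn₁ : ∀ j ∈ J, (c₁ j).Nodup) (hn₂ : ∀ j ∈ J, (c₂ j).Nodup)
    (hne₁ : ∀ j ∈ J, c₁ j ≠ b₁ j) (hne₂ : ∀ j ∈ J, c₁ j ≠ b₂ j)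
    (htr : ∀ j ∈ J, ∀ s : List Y, s.length = 2 → s.Nodup →
      ((if s.Sublist (b₁ j) then 1 else 0) + (if s.Sublist (b₂ j) then 1 else 0) : ℕ) =
        (if s.Sublist (c₁ j) then 1 else 0) + (if s.Sublist (c₂ j) then 1 else 0)) :
    D.DefiningHalf := by
  classical
  intro S hS
  obtain ⟨hSD, huniq⟩ := hS
  have key : ∀ j ∈ J, b₁ j ∈ S ∨ b₂ j ∈ S := by
    intro j hj
    by_contra hcon
    push Not at hcon
    obtain ⟨h1, h2⟩ := hcon
    have hle : ({b₁ j} + {b₂ j} : Multiset (List Y)) ≤ D.blocks := by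
      rw [hD]
      refine add_le_add ?_ ?_ <;> rw [Multiset.singleton_le] <;>
        exact Multiset.mem_map_of_mem _ hj
    obtain ⟨R, hR⟩ := Multiset.le_iff_exists_add.mp hle
    have hSR : S ≤ R := by
      rw [Multiset.le_iff_count]
      intro a
      have hc := Multiset.le_iff_count.mp hSD a
      rw [hR, Multiset.count_add, Multiset.count_add] at hc
      by_cases e1 : a = b₁ j
      · subst e1; rw [Multiset.count_eq_zero_of_notMem h1]; exact Nat.zero_le _
      · by_cases e2 : a = b₂ j
        · subst e2; rw [Multiset.count_eq_zero_of_notMem h2]; exact Nat.zero_le _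
        · simpa [Multiset.count_singleton, e1, e2] using hc
    let D' : DirectedDesign Y 2 4 2 :=
      { blocks := {c₁ j} + {c₂ j} + R
        len := by
          intro b hb
          simp only [Multiset.mem_add, Multiset.mem_singleton] at hb
          rcases hb with (rfl | rfl) | hb
          · exact hl₁ j hj
          · exact hl₂ j hj
          · exact D.len b (by rw [hR]; exact Multiset.mem_add.mpr (Or.inr hb))
        nodup := by
          intro b hb
          simp only [Multiset.mem_add, Multiset.mem_singleton] at hb
          rcases hb with (rfl | rfl) | hb
          · exact hn₁ j hj
          · exact hn₂ j hj
          · exact D.nodup b (by rw [hR]; exact Multiset.mem_add.mpr (Or.inr hb))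
        covers := by
          intro s hs hsn
          have hc := D.covers s hs hsn
          rw [hR] at hc
          have ht := htr j hj s hs hsn
          simp only [Multiset.countP_add, ← Multiset.cons_zero, Multiset.countP_cons,
            Multiset.countP_zero, zero_add] at hc ⊢
          omega }
    have he := huniq D' (hSR.trans (Multiset.le_add_left _ _))
    have he2 : ({c₁ j} + {c₂ j} + R : Multiset (List Y)) = {b₁ j} + {b₂ j} + R := by
      rw [← hR]; exact he
    have he3 := add_right_cancel he2
    have hm : c₁ j ∈ ({b₁ j} + {b₂ j} : Multiset (List Y)) := by
      rw [← he3]; simp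
    simp only [Multiset.mem_add, Multiset.mem_singleton] at hm
    rcases hm with h | h
    · exact hne₁ j hj h
    · exact hne₂ j hj h
  have hle : (J.filter (fun j => b₁ j ∈ S)).val.map b₁ +
      (J.filter (fun j => b₂ j ∈ S)).val.map b₂ ≤ S := by
    have hn : ((J.filter (fun j => b₁ j ∈ S)).val.map b₁ +
      (J.filter (fun j => b₂ j ∈ S)).val.map b₂).Nodup := by
      refine Multiset.nodup_of_le ?_ hnd
      rw [hD]
      exact add_le_add (Multiset.map_le_map (Finset.val_le_iff.mpr (Finset.filter_subset _ _)))
        (Multiset.map_le_map (Finset.val_le_iff.mpr (Finset.filter_subset _ _)))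
    rw [Multiset.le_iff_subset hn]
    intro a ha
    simp only [Multiset.mem_add, Multiset.mem_map, Finset.mem_val, Finset.mem_filter] at ha
    rcases ha with ⟨j, hj, rfl⟩ | ⟨j, hj, rfl⟩
    · exact hj.2
    · exact hj.2
  have hcard := Multiset.card_le_card hle
  simp only [Multiset.card_add, Multiset.card_map, Finset.card_val] at hcard
  have hJ : J.card ≤ (J.filter (fun j => b₁ j ∈ S)).card +
      (J.filter (fun j => b₂ j ∈ S)).card := by
    refine le_trans (Finset.card_le_card ?_) (Finset.card_union_le _ _)
    intro j hj
    rcases key j hj with h | h <;> simp [hj, h]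
  rw [hD]
  simp only [Multiset.card_add, Multiset.card_map, Finset.card_val]
  omega

/-! ### Difference families -/

/-- A base point `(residue mod p, class mod m)`. -/
abbrev Pt := ℕ × ℕ

/-- A base block. -/
abbrev Blk := Pt × Pt × Pt × Pt

/-- `(x, y, z, w, u, v)` stands for the two base blocks
`(x, y, z, w)` and `(y, x, u, v)`. -/
abbrev Row := Pt × Pt × Pt × Pt × Pt × Pt

def fstB : Row → Blk
  | (x, y, z, w, _, _) => (x, y, z, w)

def sndB : Row → Blk
  | (x, y, _, _, z, w) => (y, x, z, w)

def allB (L : List Row) : List Blk := L.map fstB ++ L.map sndB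

def good (p m : ℕ) : Blk → Prop
  | (a, b, c, d) => a.1 < p ∧ b.1 < p ∧ c.1 < p ∧ d.1 < p ∧
      a.2 < m ∧ b.2 < m ∧ c.2 < m ∧ d.2 < m ∧ [a, b, c, d].Nodup

instance (p m : ℕ) (B : Blk) : Decidable (good p m B) := by
  unfold good; infer_instance

def enc (p m : ℕ) (P Q : Pt) : ℕ := (P.2 * m + Q.2) * p + (Q.1 + (p - 1) * P.1) % p

def encs (p m : ℕ) : Blk → List ℕ
  | (a, b, c, d) => [enc p m a b, enc p m a c, enc p m a d, enc p m b c, enc p m b d, enc p m c d]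

def codes (p m : ℕ) (L : List Row) : List ℕ := (allB L).flatMap (encs p m)

def tri : Blk → ℕ → Pt × Pt × Pt
  | (_, b, c, d), 0 => (b, c, d)
  | (a, _, c, d), 1 => (a, c, d)
  | (a, b, _, d), 2 => (a, b, d)
  | (a, b, c, _), _ => (a, b, c)

def term (p m s : ℕ) (P : Pt) : ℕ := ((3 * P.1 + (p - 1) * s) % p * m + P.2) ^ 4

def nkey (p m : ℕ) : Pt × Pt × Pt → ℕ
  | (P, Q, R) => term p m (P.1 + Q.1 + R.1) P + term p m (P.1 + Q.1 + R.1) Q +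
      term p m (P.1 + Q.1 + R.1) R

/-- The finite conditions on a list of rows. -/
structure Check (p m : ℕ) (L : List Row) : Prop where
  good : ∀ B ∈ allB L, good p m B
  cnt : ∀ c < m, ∀ c' < m, ∀ d < p, (c = c' ∧ d = 0) ∨
    (codes p m L).count ((c * m + c') * p + d) = 2
  keys : ((allB L ×ˢ List.range 4).map (fun q => nkey p m (tri q.1 q.2))).Nodup

section
variable {Y : Type*} [DecidableEq Y] {p m : ℕ} [NeZero p] [NeZero m]
  (φ : ZMod p × ZMod m ≃ Y)

def pt (P : Pt) (t : ZMod p) : Y := φ ((P.1 : ZMod p) + t, (P.2 : ZMod m))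

def blk : Blk → ZMod p → List Y
  | (a, b, c, d), t => [pt φ a t, pt φ b t, pt φ c t, pt φ d t]

lemma cast_inj {n a b : ℕ} (ha : a < n) (hb : b < n) (h : (a : ZMod n) = b) : a = b := by
  rw [ZMod.natCast_eq_natCast_iff'] at h
  rwa [Nat.mod_eq_of_lt ha, Nat.mod_eq_of_lt hb] at h

lemma pt_inj {P Q : Pt} {t : ZMod p} (h1 : P.1 < p) (h2 : Q.1 < p) (h3 : P.2 < m)
    (h4 : Q.2 < m) : pt φ P t = pt φ Q t ↔ P = Q := by
  constructor
  · intro h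
    have h := φ.injective h
    rw [Prod.mk.injEq] at h
    exact Prod.ext (cast_inj h1 h2 (add_right_cancel h.1)) (cast_inj h3 h4 h.2)
  · rintro rfl; rfl

lemma blk_nodup {B : Blk} (h : good p m B) (t : ZMod p) : (blk φ B t).Nodup := by
  obtain ⟨a, b, c, d⟩ := B
  obtain ⟨h1, h2, h3, h4, h5, h6, h7, h8, h⟩ := h
  simp only [blk, List.nodup_cons, List.mem_cons, List.not_mem_nil, or_false, not_or] at h ⊢
  rw [pt_inj φ h1 h2 h5 h6, pt_inj φ h1 h3 h5 h7, pt_inj φ h1 h4 h5 h8, pt_inj φ h2 h3 h6 h7,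
    pt_inj φ h2 h4 h6 h8, pt_inj φ h3 h4 h7 h8]
  exact ⟨h.1, h.2.1, h.2.2.1, not_false, List.nodup_nil⟩

lemma blk_len (B : Blk) (t : ZMod p) : (blk φ B t).length = 4 := rfl

lemma pred_cast : ((p - 1 : ℕ) : ZMod p) = -1 := by
  have : 1 ≤ p := Nat.one_le_iff_ne_zero.mpr (NeZero.ne p)
  rw [Nat.cast_sub this]; simp

/-- The code of an ordered pair of points. -/
def kap (x y : Y) : ℕ :=
  ((φ.symm x).2.val * m + (φ.symm y).2.val) * p + ((φ.symm y).1 - (φ.symm x).1).val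

lemma enc_iff {P Q : Pt} (h3 : P.2 < m) (h4 : Q.2 < m) (x y : Y) :
    enc p m P Q = kap φ x y ↔ (P.2 : ZMod m) = (φ.symm x).2 ∧ (Q.2 : ZMod m) = (φ.symm y).2 ∧
      (Q.1 : ZMod p) - P.1 = (φ.symm y).1 - (φ.symm x).1 := by
  have hp : 0 < p := Nat.pos_of_ne_zero (NeZero.ne p)
  have hm : 0 < m := Nat.pos_of_ne_zero (NeZero.ne m)
  have e1 : (Q.1 + (p - 1) * P.1) % p = ((Q.1 : ZMod p) - P.1).val := by
    rw [← ZMod.val_natCast]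
    congr 1
    push_cast
    rw [pred_cast]; ring
  have v3 : (P.2 : ZMod m).val = P.2 := ZMod.val_cast_of_lt h3
  have v4 : (Q.2 : ZMod m).val = Q.2 := ZMod.val_cast_of_lt h4
  have mix : ∀ n a b a' b' : ℕ, b < n → b' < n → (a * n + b = a' * n + b' ↔ a = a' ∧ b = b') := by
    intro n a b a' b' hb hb'
    constructor
    · intro h
      have hn : 0 < n := by omega
      have h1 := congrArg (· / n) h
      have h2 := congrArg (· % n) h
      simp only [Nat.mul_comm _ n, Nat.mul_add_div hn, Nat.mul_add_mod, Nat.div_eq_of_lt hb,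
        Nat.div_eq_of_lt hb', Nat.mod_eq_of_lt hb, Nat.mod_eq_of_lt hb', Nat.add_zero] at h1 h2
      exact ⟨h1, h2⟩
    · rintro ⟨rfl, rfl⟩; rfl
  unfold enc kap
  rw [e1, mix _ _ _ _ _ (ZMod.val_lt _) (ZMod.val_lt _), mix _ _ _ _ _ h4 (ZMod.val_lt _)]
  rw [(ZMod.val_injective p).eq_iff, and_assoc]
  conv_lhs => rw [← v3, ← v4]
  rw [(ZMod.val_injective m).eq_iff, (ZMod.val_injective m).eq_iff]

lemma sum_t {P Q : Pt} (h3 : P.2 < m) (h4 : Q.2 < m) (x y : Y) :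
    (∑ t : ZMod p, if pt φ P t = x ∧ pt φ Q t = y then 1 else 0 : ℕ) =
      if enc p m P Q = kap φ x y then 1 else 0 := by
  have hpt : ∀ (P : Pt) (t : ZMod p) (x : Y), pt φ P t = x ↔
      t = (φ.symm x).1 - P.1 ∧ (P.2 : ZMod m) = (φ.symm x).2 := by
    intro P t x
    unfold pt
    rw [← Equiv.eq_symm_apply, Prod.ext_iff]
    simp only [eq_sub_iff_add_eq, add_comm]
  by_cases he : enc p m P Q = kap φ x y
  · rw [if_pos he, Finset.sum_eq_single ((φ.symm x).1 - (P.1 : ZMod p))]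
    · obtain ⟨e1, e2, e3⟩ := (enc_iff φ h3 h4 x y).mp he
      rw [if_pos]
      rw [hpt, hpt]
      refine ⟨⟨rfl, e1⟩, ?_, e2⟩
      linear_combination e3
    · intro t _ ht
      rw [if_neg]
      rw [hpt]
      exact fun h => ht h.1.1
    · simp
  · rw [if_neg he]
    refine Finset.sum_eq_zero fun t _ => ?_
    rw [if_neg]
    rintro ⟨h1, h2⟩
    rw [hpt] at h1 h2
    refine he ((enc_iff φ h3 h4 x y).mpr ⟨h1.2, h2.2, ?_⟩)
    linear_combination h2.1 - h1.1

lemma sum_blk {B : Blk} (hB : good p m B) (x y : Y) :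
    (∑ t : ZMod p, if [x, y].Sublist (blk φ B t) then 1 else 0 : ℕ) =
      (encs p m B).count (kap φ x y) := by
  have hn := fun t => blk_nodup φ hB t
  obtain ⟨a, b, c, d⟩ := B
  obtain ⟨h1, h2, h3, h4, h5, h6, h7, h8, h⟩ := hB
  have hi := fun t => ind4 x y _ _ _ _ (hn t)
  refine (Finset.sum_congr rfl fun t _ => hi t).trans ?_
  simp only [Finset.sum_add_distrib]
  rw [sum_t φ h5 h6, sum_t φ h5 h7, sum_t φ h5 h8, sum_t φ h6 h7, sum_t φ h6 h8, sum_t φ h7 h8]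
  simp only [encs, List.count_cons, List.count_nil, beq_iff_eq]
  omega

/-- Translation invariant of a set of points. -/
noncomputable def fkey (T : Finset Y) : ℕ :=
  ∑ x ∈ T, ((3 * (φ.symm x).1 - ∑ y ∈ T, (φ.symm y).1).val * m + (φ.symm x).2.val) ^ 4

lemma fkey_eq (P Q R : Pt) (t : ZMod p) (hP : P.2 < m) (hQ : Q.2 < m) (hR : R.2 < m)
    (h1 : pt φ P t ≠ pt φ Q t) (h2 : pt φ P t ≠ pt φ R t) (h3 : pt φ Q t ≠ pt φ R t) :
    fkey φ {pt φ P t, pt φ Q t, pt φ R t} = nkey p m (P, Q, R) := by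
  have hs : ∀ f : Y → ℕ, ∑ x ∈ {pt φ P t, pt φ Q t, pt φ R t}, f x =
      f (pt φ P t) + f (pt φ Q t) + f (pt φ R t) := by
    intro f
    rw [Finset.sum_insert (by simp [h1, h2]), Finset.sum_insert (by simp [h3]),
      Finset.sum_singleton, add_assoc]
  have hs' : ∀ f : Y → ZMod p, ∑ x ∈ {pt φ P t, pt φ Q t, pt φ R t}, f x =
      f (pt φ P t) + f (pt φ Q t) + f (pt φ R t) := by
    intro f
    rw [Finset.sum_insert (by simp [h1, h2]), Finset.sum_insert (by simp [h3]),
      Finset.sum_singleton, add_assoc]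
  unfold fkey
  rw [hs', hs]
  have hterm : ∀ A : Pt, A.2 < m → ((3 * (φ.symm (pt φ A t)).1 - ((φ.symm (pt φ P t)).1 +
      (φ.symm (pt φ Q t)).1 + (φ.symm (pt φ R t)).1)).val * m + (φ.symm (pt φ A t)).2.val) ^ 4 =
      term p m (P.1 + Q.1 + R.1) A := by
    intro A hA
    unfold term pt
    simp only [Equiv.symm_apply_apply]
    rw [ZMod.val_cast_of_lt hA, ← ZMod.val_natCast]
    congr 4
    push_cast
    rw [pred_cast]
    ring
  rw [hterm P hP, hterm Q hQ, hterm R hR]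
  rfl

lemma three_of_four {a b c d : Y} {T : Finset Y} (hT : T ⊆ {a, b, c, d}) (h3 : T.card = 3) :
    T = {b, c, d} ∨ T = {a, c, d} ∨ T = {a, b, d} ∨ T = {a, b, c} := by
  have aux : ∀ (U : Finset Y), U.card ≤ 3 → T ⊆ U → T = U := fun U hU hTU =>
    Finset.eq_of_subset_of_card_le hTU (by omega)
  have h : a ∉ T ∨ b ∉ T ∨ c ∉ T ∨ d ∉ T ∨
      (a ∈ T ∧ b ∈ T ∧ c ∈ T ∧ d ∈ T) := by tauto
  have step : ∀ {u : Y}, u ∉ T → ∀ x ∈ T, x ≠ u := fun hu x hx e => hu (e ▸ hx)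
  have hT' : ∀ x ∈ T, x = a ∨ x = b ∨ x = c ∨ x = d := by
    intro x hx; simpa using hT hx
  rcases h with h | h | h | h | h
  · left; refine aux _ Finset.card_le_three fun x hx => ?_
    have := hT' x hx; have := step h x hx; simp; tauto
  · right; left; refine aux _ Finset.card_le_three fun x hx => ?_
    have := hT' x hx; have := step h x hx; simp; tauto
  · right; right; left; refine aux _ Finset.card_le_three fun x hx => ?_
    have := hT' x hx; have := step h x hx; simp; tauto
  · right; right; right; refine aux _ Finset.card_le_three fun x hx => ?_
    have := hT' x hx; have := step h x hx; simp; tauto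
  · have hE : T = {a, b, c, d} := by
      refine Finset.Subset.antisymm hT fun x hx => ?_
      simp only [Finset.mem_insert, Finset.mem_singleton] at hx
      rcases hx with rfl | rfl | rfl | rfl <;> tauto
    have hq : a = b ∨ a = c ∨ a = d ∨ b = c ∨ b = d ∨ c = d := by
      by_contra hq
      push Not at hq
      obtain ⟨q1, q2, q3, q4, q5, q6⟩ := hq
      have : T.card = 4 := by
        rw [hE, Finset.card_eq_of_equiv_fin]
        exact Fintype.equivFinOfCardEq (by simp [q1, q2, q3, q4, q5, q6])
      omega
    rw [hE]
    rcases hq with rfl | rfl | rfl | rfl | rfl | rfl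
    · left; ext; simp
    · left; ext; simp
    · left; ext; simp
    · right; left; ext; simp
    · right; left; ext; simp
    · right; right; left; ext; simp

/-- A three-element subset of a block comes from one of its four triples. -/
lemma fkey_sub {B : Blk} (hB : good p m B) (t : ZMod p) {T : Finset Y}
    (hT : T ⊆ (blk φ B t).toFinset) (h3 : T.card = 3) :
    ∃ k < 4, fkey φ T = nkey p m (tri B k) ∧
      ∑ x ∈ T, (φ.symm x).1 = ((tri B k).1.1 + (tri B k).2.1.1 + (tri B k).2.2.1 : ℕ) + 3 * t := by
  have hn := blk_nodup φ hB t
  obtain ⟨a, b, c, d⟩ := B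
  obtain ⟨-, -, -, -, h5, h6, h7, h8, -⟩ := hB
  simp only [blk, List.nodup_cons, List.mem_cons, List.not_mem_nil, or_false, not_or] at hn
  obtain ⟨⟨n1, n2, n3⟩, ⟨n4, n5⟩, n6, -⟩ := hn
  have hs : ∀ P Q R : Pt, pt φ P t ≠ pt φ Q t → pt φ P t ≠ pt φ R t → pt φ Q t ≠ pt φ R t →
      ∑ x ∈ {pt φ P t, pt φ Q t, pt φ R t}, (φ.symm x).1 =
      ((P.1 + Q.1 + R.1 : ℕ) : ZMod p) + 3 * t := by
    intro P Q R h1 h2 h3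
    rw [Finset.sum_insert (by simp [h1, h2]), Finset.sum_insert (by simp [h3]),
      Finset.sum_singleton]
    simp only [pt, Equiv.symm_apply_apply]
    push_cast
    ring
  have hT' : T ⊆ {pt φ a t, pt φ b t, pt φ c t, pt φ d t} := by
    simpa [blk] using hT
  rcases three_of_four hT' h3 with rfl | rfl | rfl | rfl
  · exact ⟨0, by norm_num, fkey_eq φ b c d t h6 h7 h8 n4 n5 n6, hs b c d n4 n5 n6⟩
  · exact ⟨1, by norm_num, fkey_eq φ a c d t h5 h7 h8 n2 n3 n6, hs a c d n2 n3 n6⟩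
  · exact ⟨2, by norm_num, fkey_eq φ a b d t h5 h6 h8 n1 n3 n5, hs a b d n1 n3 n5⟩
  · exact ⟨3, by norm_num, fkey_eq φ a b c t h5 h6 h7 n1 n2 n4, hs a b c n1 n2 n4⟩

variable {L : List Row}

lemma inter_le (hL : Check p m L) (h3 : IsUnit (3 : ZMod p)) {B B' : Blk} (hB : B ∈ allB L) (hB' : B' ∈ allB L)
    {t t' : ZMod p}
    (h : ¬ ((blk φ B t).toFinset ∩ (blk φ B' t').toFinset).card ≤ 2) : B = B' ∧ t = t' := by
  obtain ⟨T, hT, hc⟩ := Finset.exists_subset_card_eq (Nat.lt_of_not_le h)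
  obtain ⟨k, hk, e1, e2⟩ := fkey_sub φ (hL.good B hB) t
    (hT.trans Finset.inter_subset_left) hc
  obtain ⟨k', hk', e1', e2'⟩ := fkey_sub φ (hL.good B' hB') t'
    (hT.trans Finset.inter_subset_right) hc
  have hq := List.inj_on_of_nodup_map hL.keys (x := (B, k)) (y := (B', k'))
    (by simp [hB, hk]) (by simp [hB', hk']) (by simp only; rw [← e1, ← e1'])
  rw [Prod.mk.injEq] at hq
  obtain ⟨rfl, rfl⟩ := hq
  refine ⟨rfl, ?_⟩
  rw [e2] at e2'
  exact h3.mul_left_cancel (add_left_cancel e2')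

lemma allB_nodup (hL : Check p m L) : (allB L).Nodup := by
  have h0 : ((allB L).flatMap fun B => (List.range 4).map (Prod.mk B)).Nodup :=
    List.Nodup.of_map _ hL.keys
  refine (List.nodup_flatMap.mp h0).2.imp ?_
  rintro a b hab rfl
  have h1 : (a, 0) ∈ (List.range 4).map (Prod.mk a) := by simp
  exact hab h1 h1

open Classical in
lemma cover_count (hL : Check p m L) (x y : Y) (hxy : x ≠ y) :
    (∑ r ∈ L.toFinset, ((∑ t : ZMod p, if [x, y].Sublist (blk φ (fstB r) t) then 1 else 0) +
      ∑ t : ZMod p, if [x, y].Sublist (blk φ (sndB r) t) then 1 else 0) : ℕ) = 2 := by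
  have hc := hL.cnt _ (ZMod.val_lt (φ.symm x).2) _ (ZMod.val_lt (φ.symm y).2) _
    (ZMod.val_lt ((φ.symm y).1 - (φ.symm x).1))
  rcases hc with ⟨h1, h2⟩ | hc
  · exfalso
    rw [ZMod.val_eq_zero, sub_eq_zero] at h2
    exact hxy (φ.symm.injective (Prod.ext h2.symm (ZMod.val_injective m h1)))
  · rw [← hc]
    change _ = (codes p m L).count (kap φ x y)
    rw [List.sum_toFinset _ (List.Nodup.of_map _ (List.nodup_append.mp (allB_nodup hL)).1), codes, List.count_flatMap, allB, List.map_append,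
      List.sum_append, List.map_map, List.map_map, ← List.sum_map_add]
    congr 1
    refine List.map_congr_left fun r hr => ?_
    rw [sum_blk φ (hL.good _ (by simp only [allB, List.mem_append, List.mem_map]; exact Or.inl ⟨r, hr, rfl⟩)),
      sum_blk φ (hL.good _ (by simp only [allB, List.mem_append, List.mem_map]; exact Or.inr ⟨r, hr, rfl⟩))]
    rfl

theorem build (φ : ZMod p × ZMod m ≃ Y) (hL : Check p m L) (h3 : IsUnit (3 : ZMod p)) :
    ∃ D : DirectedDesign Y 2 4 2, D.SuperSimple ∧ D.DefiningHalf := by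
  classical
  have m1 : ∀ r ∈ L, fstB r ∈ allB L := fun r hr => by
    simp only [allB, List.mem_append, List.mem_map]; exact Or.inl ⟨r, hr, rfl⟩
  have m2 : ∀ r ∈ L, sndB r ∈ allB L := fun r hr => by
    simp only [allB, List.mem_append, List.mem_map]; exact Or.inr ⟨r, hr, rfl⟩
  let J : Finset (Row × ZMod p) := L.toFinset ×ˢ Finset.univ
  let b₁ : Row × ZMod p → List Y := fun j => blk φ (fstB j.1) j.2
  let b₂ : Row × ZMod p → List Y := fun j => blk φ (sndB j.1) j.2
  have hJ : ∀ j, j ∈ J ↔ j.1 ∈ L := fun j => by simp [J]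
  have hmem : ∀ b, b ∈ J.val.map b₁ + J.val.map b₂ → ∃ B ∈ allB L, ∃ t, b = blk φ B t := by
    intro b hb
    simp only [Multiset.mem_add, Multiset.mem_map, Finset.mem_val, hJ] at hb
    rcases hb with ⟨j, hj, rfl⟩ | ⟨j, hj, rfl⟩
    · exact ⟨_, m1 _ hj, _, rfl⟩
    · exact ⟨_, m2 _ hj, _, rfl⟩
  have hinj : ∀ B ∈ allB L, ∀ B' ∈ allB L, ∀ t t', blk φ B t = blk φ B' t' → B = B' ∧ t = t' := by
    intro B hB B' hB' t t' h
    refine inter_le φ hL h3 hB hB' ?_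
    rw [← h, Finset.inter_self, List.toFinset_card_of_nodup (blk_nodup φ (hL.good B hB) t),
      blk_len]
    norm_num
  have hLnd := allB_nodup hL
  have hnd : (J.val.map b₁ + J.val.map b₂).Nodup := by
    have hdis := (List.nodup_append.mp hLnd)
    rw [Multiset.nodup_add]
    refine ⟨?_, ?_, ?_⟩
    · refine Multiset.Nodup.map_on ?_ J.nodup
      intro j hj j' hj' h
      rw [Finset.mem_val, hJ] at hj hj'
      obtain ⟨e1, e2⟩ := hinj _ (m1 _ hj) _ (m1 _ hj') _ _ h
      exact Prod.ext (List.inj_on_of_nodup_map hdis.1 hj hj' e1) e2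
    · refine Multiset.Nodup.map_on ?_ J.nodup
      intro j hj j' hj' h
      rw [Finset.mem_val, hJ] at hj hj'
      obtain ⟨e1, e2⟩ := hinj _ (m2 _ hj) _ (m2 _ hj') _ _ h
      exact Prod.ext (List.inj_on_of_nodup_map hdis.2.1 hj hj' e1) e2
    · rw [Multiset.disjoint_left]
      intro b hb hb'
      simp only [Multiset.mem_map, Finset.mem_val, hJ] at hb hb'
      obtain ⟨j, hj, rfl⟩ := hb
      obtain ⟨j', hj', h⟩ := hb'
      obtain ⟨e1, e2⟩ := hinj _ (m2 _ hj') _ (m1 _ hj) _ _ h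
      exact hdis.2.2 _ (List.mem_map_of_mem hj) _ (List.mem_map_of_mem hj') e1.symm
  let D : DirectedDesign Y 2 4 2 :=
    { blocks := J.val.map b₁ + J.val.map b₂
      len := by
        intro b hb
        obtain ⟨B, hB, t, rfl⟩ := hmem b hb
        rfl
      nodup := by
        intro b hb
        obtain ⟨B, hB, t, rfl⟩ := hmem b hb
        exact blk_nodup φ (hL.good B hB) t
      covers := by
        intro s hs hsn
        obtain ⟨x, y, rfl⟩ := List.length_eq_two.mp hs
        have hxy : x ≠ y := by simpa using hsn
        have hcnt : ∀ b : Row × ZMod p → List Y,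
            (J.val.map b).countP (fun b => [x, y].Sublist b) =
            ∑ r ∈ L.toFinset, ∑ t : ZMod p, if [x, y].Sublist (b (r, t)) then 1 else 0 := by
          intro b
          rw [← Finset.sum_product', Multiset.countP_map, ← Finset.card_filter]
          rfl
        rw [Multiset.countP_add, hcnt, hcnt, ← Finset.sum_add_distrib]
        exact cover_count φ hL x y hxy }
  refine ⟨D, ⟨hnd, ?_⟩, ?_⟩
  · intro b hb b' hb' hne
    obtain ⟨B, hB, t, rfl⟩ := hmem b hb
    obtain ⟨B', hB', t', rfl⟩ := hmem b' hb'
    by_contra hcon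
    obtain ⟨rfl, rfl⟩ := inter_le φ hL h3 hB hB' hcon
    exact hne rfl
  · let c₁ : Row × ZMod p → List Y := fun j => match j.1, j.2 with
      | (x, y, z, w, _, _), t => [pt φ y t, pt φ x t, pt φ z t, pt φ w t]
    let c₂ : Row × ZMod p → List Y := fun j => match j.1, j.2 with
      | (x, y, _, _, z, w), t => [pt φ x t, pt φ y t, pt φ z t, pt φ w t]
    have hb1 : ∀ j ∈ J, (b₁ j).Nodup := fun j hj =>
      blk_nodup φ (hL.good _ (m1 _ ((hJ j).mp hj))) _
    have hb2 : ∀ j ∈ J, (b₂ j).Nodup := fun j hj =>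
      blk_nodup φ (hL.good _ (m2 _ ((hJ j).mp hj))) _
    have hc1 : ∀ j ∈ J, (c₁ j).Nodup := by
      rintro ⟨⟨x, y, z, w, z', w'⟩, t⟩ hj
      exact ((List.Perm.swap _ _ _).nodup_iff).mp (hb1 _ hj)
    have hc2 : ∀ j ∈ J, (c₂ j).Nodup := by
      rintro ⟨⟨x, y, z, w, z', w'⟩, t⟩ hj
      exact ((List.Perm.swap _ _ _).nodup_iff).mp (hb2 _ hj)
    refine half J b₁ b₂ c₁ c₂ D rfl hnd ?_ ?_ hc1 hc2 ?_ ?_ ?_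
    · rintro ⟨⟨x, y, z, w, z', w'⟩, t⟩ hj; rfl
    · rintro ⟨⟨x, y, z, w, z', w'⟩, t⟩ hj; rfl
    · rintro ⟨⟨x, y, z, w, z', w'⟩, t⟩ hj h
      have hn := hb1 _ hj
      simp only [b₁, c₁, blk, fstB, List.cons.injEq] at h hn
      simp [h.1] at hn
    · rintro ⟨⟨x, y, z, w, z', w'⟩, t⟩ hj h
      have hle := inter_le φ hL h3 (m1 _ ((hJ _).mp hj)) (m2 _ ((hJ _).mp hj)) (t := t) (t' := t)
        (by
          have hn := hb1 _ hj
          have hs : (blk φ (sndB (x, y, z, w, z', w')) t).toFinset =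
              (blk φ (fstB (x, y, z, w, z', w')) t).toFinset := by
            have h' : blk φ (sndB (x, y, z, w, z', w')) t =
                [pt φ y t, pt φ x t, pt φ z t, pt φ w t] := h.symm
            rw [h']
            simp only [blk, fstB]
            exact List.toFinset_eq_of_perm _ _ (List.Perm.swap _ _ _)
          rw [hs, Finset.inter_self, List.toFinset_card_of_nodup hn]
          simp [b₁, blk_len])
      have hg := hL.good _ (m1 _ ((hJ _).mp hj))
      have := hle.1
      simp only [fstB, sndB, Prod.mk.injEq] at this hg
      simp [good, this.1] at hg
    · rintro ⟨⟨x, y, z, w, z', w'⟩, t⟩ hj s hs hsn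
      obtain ⟨u, v, rfl⟩ := List.length_eq_two.mp hs
      have n1 := hb1 _ hj
      have n2 := hb2 _ hj
      have n3 := hc1 _ hj
      have n4 := hc2 _ hj
      have i1 := ind4 u v _ _ _ _ n1
      have i2 := ind4 u v _ _ _ _ n2
      have i3 := ind4 u v _ _ _ _ n3
      have i4 := ind4 u v _ _ _ _ n4
      refine (congrArg₂ (· + ·) i1 i2).trans (Eq.trans ?_ (congrArg₂ (· + ·) i3 i4).symm)
      simp only
      omega

end


theorem build_fin (p m : ℕ) [NeZero p] [NeZero m] (L : List Row) (hL : Check p m L)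
    (h3 : Nat.Coprime 3 p) :
    ∃ D : DirectedDesign (Fin (p * m)) 2 4 2, D.SuperSimple ∧ D.DefiningHalf := by
  have φ : ZMod p × ZMod m ≃ Fin (p * m) :=
    Fintype.equivFinOfCardEq (by rw [Fintype.card_prod, ZMod.card, ZMod.card])
  exact build φ hL (by exact_mod_cast (ZMod.isUnit_iff_coprime 3 p).mpr h3)

def rows55 : List Row :=
  [⟨(0, 0), (24, 0), (34, 0), (22, 0), (45, 0), (2, 0)⟩,
   ⟨(0, 0), (20, 0), (30, 0), (48, 0), (45, 0), (27, 0)⟩,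
   ⟨(0, 0), (43, 0), (52, 0), (32, 0), (46, 0), (11, 0)⟩,
   ⟨(0, 0), (42, 0), (28, 0), (4, 0), (14, 0), (38, 0)⟩,
   ⟨(0, 0), (26, 0), (34, 0), (9, 0), (47, 0), (17, 0)⟩,
   ⟨(0, 0), (49, 0), (5, 0), (13, 0), (44, 0), (36, 0)⟩,
   ⟨(0, 0), (39, 0), (40, 0), (37, 0), (54, 0), (2, 0)⟩,
   ⟨(0, 0), (29, 0), (6, 0), (22, 0), (23, 0), (7, 0)⟩,
   ⟨(0, 0), (14, 0), (50, 0), (54, 0), (19, 0), (15, 0)⟩]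

def rows82 : List Row :=
  [⟨(0, 1), (37, 0), (21, 1), (35, 0), (16, 0), (2, 1)⟩,
   ⟨(0, 1), (2, 0), (27, 0), (36, 0), (16, 1), (7, 1)⟩,
   ⟨(0, 0), (40, 1), (4, 0), (6, 0), (36, 1), (34, 1)⟩,
   ⟨(0, 1), (34, 0), (15, 0), (29, 0), (19, 1), (5, 1)⟩,
   ⟨(0, 0), (3, 1), (26, 0), (24, 0), (18, 1), (20, 1)⟩,
   ⟨(0, 1), (32, 0), (20, 0), (37, 0), (12, 1), (36, 1)⟩,
   ⟨(0, 0), (25, 1), (25, 0), (33, 0), (0, 1), (33, 1)⟩,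
   ⟨(0, 1), (26, 0), (33, 0), (3, 0), (34, 1), (23, 1)⟩,
   ⟨(0, 1), (35, 0), (13, 0), (28, 0), (22, 1), (7, 1)⟩,
   ⟨(0, 1), (9, 0), (25, 0), (22, 0), (25, 1), (28, 1)⟩,
   ⟨(0, 0), (32, 1), (15, 0), (33, 0), (17, 1), (40, 1)⟩,
   ⟨(0, 0), (1, 1), (12, 0), (6, 0), (30, 1), (36, 1)⟩,
   ⟨(0, 1), (39, 0), (26, 0), (22, 0), (13, 1), (17, 1)⟩,
   ⟨(0, 1), (28, 0), (10, 0), (38, 0), (18, 1), (31, 1)⟩,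
   ⟨(0, 0), (18, 1), (20, 0), (1, 0), (39, 1), (17, 1)⟩,
   ⟨(0, 0), (26, 1), (3, 0), (30, 0), (23, 1), (37, 1)⟩,
   ⟨(0, 1), (39, 0), (10, 0), (0, 0), (29, 1), (39, 1)⟩,
   ⟨(0, 0), (9, 1), (8, 0), (38, 0), (1, 1), (12, 1)⟩,
   ⟨(0, 1), (31, 0), (34, 0), (30, 0), (38, 1), (1, 1)⟩,
   ⟨(0, 1), (30, 0), (21, 0), (6, 0), (9, 1), (24, 1)⟩,
   ⟨(0, 0), (22, 1), (29, 0), (1, 0), (34, 1), (21, 1)⟩,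
   ⟨(0, 0), (33, 1), (4, 0), (9, 0), (29, 1), (24, 1)⟩,
   ⟨(0, 1), (4, 0), (31, 0), (25, 0), (14, 1), (20, 1)⟩,
   ⟨(0, 0), (35, 1), (11, 0), (21, 0), (24, 1), (14, 1)⟩,
   ⟨(0, 0), (22, 1), (36, 0), (14, 0), (27, 1), (8, 1)⟩,
   ⟨(0, 0), (5, 1), (16, 0), (23, 0), (30, 1), (23, 1)⟩,
   ⟨(0, 0), (28, 1), (40, 0), (31, 0), (29, 1), (38, 1)⟩]

def rows85 : List Row :=
  [⟨(0, 0), (72, 0), (50, 0), (11, 0), (22, 0), (61, 0)⟩,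
   ⟨(0, 0), (49, 0), (76, 0), (43, 0), (58, 0), (6, 0)⟩,
   ⟨(0, 0), (10, 0), (78, 0), (14, 0), (17, 0), (81, 0)⟩,
   ⟨(0, 0), (31, 0), (76, 0), (26, 0), (40, 0), (5, 0)⟩,
   ⟨(0, 0), (23, 0), (20, 0), (84, 0), (3, 0), (24, 0)⟩,
   ⟨(0, 0), (30, 0), (43, 0), (47, 0), (72, 0), (68, 0)⟩,
   ⟨(0, 0), (19, 0), (58, 0), (60, 0), (46, 0), (44, 0)⟩,
   ⟨(0, 0), (37, 0), (56, 0), (36, 0), (66, 0), (1, 0)⟩,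
   ⟨(0, 0), (60, 0), (63, 0), (12, 0), (82, 0), (48, 0)⟩,
   ⟨(0, 0), (69, 0), (41, 0), (74, 0), (28, 0), (80, 0)⟩,
   ⟨(0, 0), (75, 0), (73, 0), (18, 0), (2, 0), (57, 0)⟩,
   ⟨(0, 0), (38, 0), (67, 0), (53, 0), (56, 0), (70, 0)⟩,
   ⟨(0, 0), (6, 0), (51, 0), (59, 0), (40, 0), (32, 0)⟩,
   ⟨(0, 0), (77, 0), (70, 0), (54, 0), (7, 0), (23, 0)⟩]

def rows106 : List Row :=
  [⟨(0, 1), (16, 0), (47, 0), (32, 1), (22, 1), (37, 0)⟩,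
   ⟨(0, 0), (16, 1), (47, 0), (52, 0), (22, 1), (17, 1)⟩,
   ⟨(0, 0), (14, 1), (19, 0), (36, 0), (48, 1), (31, 1)⟩,
   ⟨(0, 0), (4, 1), (42, 0), (13, 0), (15, 1), (44, 1)⟩,
   ⟨(0, 1), (10, 0), (38, 0), (35, 0), (25, 1), (28, 1)⟩,
   ⟨(0, 0), (19, 1), (42, 0), (26, 0), (30, 1), (46, 1)⟩,
   ⟨(0, 1), (49, 0), (30, 0), (50, 0), (19, 1), (52, 1)⟩,
   ⟨(0, 0), (46, 1), (35, 0), (49, 0), (11, 1), (50, 1)⟩,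
   ⟨(0, 1), (8, 0), (47, 0), (20, 0), (14, 1), (41, 1)⟩,
   ⟨(0, 1), (44, 0), (16, 0), (29, 0), (28, 1), (15, 1)⟩,
   ⟨(0, 1), (13, 0), (35, 0), (17, 0), (31, 1), (49, 1)⟩,
   ⟨(0, 0), (42, 1), (47, 0), (37, 0), (48, 1), (5, 1)⟩,
   ⟨(0, 0), (28, 1), (3, 0), (11, 0), (25, 1), (17, 1)⟩,
   ⟨(0, 1), (1, 0), (45, 0), (2, 0), (9, 1), (52, 1)⟩,
   ⟨(0, 1), (23, 0), (19, 0), (18, 0), (4, 1), (5, 1)⟩,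
   ⟨(0, 1), (12, 0), (21, 0), (51, 0), (44, 1), (14, 1)⟩,
   ⟨(0, 1), (26, 0), (1, 0), (3, 0), (25, 1), (23, 1)⟩,
   ⟨(0, 0), (21, 1), (41, 0), (48, 0), (33, 1), (26, 1)⟩,
   ⟨(0, 1), (2, 0), (21, 0), (11, 0), (34, 1), (44, 1)⟩,
   ⟨(0, 0), (1, 1), (27, 0), (32, 0), (27, 1), (22, 1)⟩,
   ⟨(0, 0), (12, 1), (27, 0), (10, 0), (38, 1), (2, 1)⟩,
   ⟨(0, 0), (10, 1), (50, 0), (14, 0), (13, 1), (49, 1)⟩,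
   ⟨(0, 1), (17, 0), (46, 0), (33, 0), (24, 1), (37, 1)⟩,
   ⟨(0, 1), (50, 0), (4, 0), (48, 0), (46, 1), (2, 1)⟩,
   ⟨(0, 0), (40, 1), (31, 0), (46, 0), (9, 1), (47, 1)⟩,
   ⟨(0, 0), (19, 1), (41, 0), (33, 0), (31, 1), (39, 1)⟩,
   ⟨(0, 0), (8, 1), (40, 0), (33, 0), (21, 1), (28, 1)⟩,
   ⟨(0, 0), (0, 1), (8, 0), (29, 0), (45, 1), (24, 1)⟩,
   ⟨(0, 0), (1, 1), (11, 0), (34, 0), (43, 1), (20, 1)⟩,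
   ⟨(0, 0), (10, 1), (24, 0), (3, 0), (39, 1), (7, 1)⟩,
   ⟨(0, 0), (29, 1), (6, 0), (4, 0), (23, 1), (25, 1)⟩,
   ⟨(0, 0), (29, 1), (16, 0), (38, 0), (13, 1), (44, 1)⟩,
   ⟨(0, 1), (27, 0), (19, 0), (42, 0), (8, 1), (38, 1)⟩,
   ⟨(0, 1), (0, 0), (12, 0), (18, 0), (41, 1), (35, 1)⟩,
   ⟨(0, 1), (39, 0), (41, 0), (6, 0), (51, 1), (33, 1)⟩]

def rows109 : List Row :=
  [⟨(0, 0), (26, 0), (29, 0), (68, 0), (106, 0), (67, 0)⟩,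
   ⟨(0, 0), (93, 0), (78, 0), (12, 0), (15, 0), (81, 0)⟩,
   ⟨(0, 0), (69, 0), (44, 0), (21, 0), (25, 0), (48, 0)⟩,
   ⟨(0, 0), (36, 0), (44, 0), (82, 0), (101, 0), (63, 0)⟩,
   ⟨(0, 0), (54, 0), (7, 0), (99, 0), (47, 0), (64, 0)⟩,
   ⟨(0, 0), (58, 0), (90, 0), (11, 0), (77, 0), (47, 0)⟩,
   ⟨(0, 0), (14, 0), (40, 0), (53, 0), (83, 0), (70, 0)⟩,
   ⟨(0, 0), (107, 0), (5, 0), (20, 0), (102, 0), (87, 0)⟩,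
   ⟨(0, 0), (87, 0), (86, 0), (75, 0), (1, 0), (12, 0)⟩,
   ⟨(0, 0), (6, 0), (19, 0), (37, 0), (96, 0), (78, 0)⟩,
   ⟨(0, 0), (74, 0), (60, 0), (106, 0), (14, 0), (77, 0)⟩,
   ⟨(0, 0), (91, 0), (81, 0), (24, 0), (10, 0), (67, 0)⟩,
   ⟨(0, 0), (60, 0), (61, 0), (55, 0), (108, 0), (5, 0)⟩,
   ⟨(0, 0), (41, 0), (74, 0), (50, 0), (76, 0), (100, 0)⟩,
   ⟨(0, 0), (38, 0), (59, 0), (8, 0), (88, 0), (30, 0)⟩,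
   ⟨(0, 0), (34, 0), (107, 0), (43, 0), (36, 0), (100, 0)⟩,
   ⟨(0, 0), (4, 0), (37, 0), (20, 0), (76, 0), (93, 0)⟩,
   ⟨(0, 0), (84, 0), (57, 0), (4, 0), (27, 0), (80, 0)⟩]

def rows118 : List Row :=
  [⟨(0, 1), (49, 0), (11, 1), (5, 0), (38, 0), (44, 1)⟩,
   ⟨(0, 0), (23, 1), (4, 0), (53, 0), (19, 1), (29, 1)⟩,
   ⟨(0, 0), (5, 1), (2, 0), (51, 0), (3, 1), (13, 1)⟩,
   ⟨(0, 1), (15, 0), (21, 0), (30, 0), (53, 1), (44, 1)⟩,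
   ⟨(0, 0), (32, 1), (44, 0), (55, 0), (47, 1), (36, 1)⟩,
   ⟨(0, 0), (45, 1), (32, 0), (10, 0), (13, 1), (35, 1)⟩,
   ⟨(0, 1), (41, 0), (44, 0), (9, 0), (56, 1), (32, 1)⟩,
   ⟨(0, 0), (25, 1), (39, 0), (18, 0), (45, 1), (7, 1)⟩,
   ⟨(0, 1), (18, 0), (11, 0), (32, 0), (7, 1), (45, 1)⟩,
   ⟨(0, 1), (8, 0), (13, 0), (49, 0), (54, 1), (18, 1)⟩,
   ⟨(0, 1), (34, 0), (6, 0), (4, 0), (28, 1), (30, 1)⟩,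
   ⟨(0, 0), (4, 1), (21, 0), (46, 0), (42, 1), (17, 1)⟩,
   ⟨(0, 0), (20, 1), (41, 0), (4, 0), (38, 1), (16, 1)⟩,
   ⟨(0, 1), (38, 0), (16, 0), (24, 0), (22, 1), (14, 1)⟩,
   ⟨(0, 1), (43, 0), (54, 0), (15, 0), (48, 1), (28, 1)⟩,
   ⟨(0, 0), (1, 1), (12, 0), (7, 0), (48, 1), (53, 1)⟩,
   ⟨(0, 1), (32, 0), (16, 0), (51, 0), (16, 1), (40, 1)⟩,
   ⟨(0, 0), (33, 1), (58, 0), (34, 0), (34, 1), (58, 1)⟩,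
   ⟨(0, 1), (31, 0), (58, 0), (53, 0), (32, 1), (37, 1)⟩,
   ⟨(0, 0), (52, 1), (32, 0), (48, 0), (20, 1), (4, 1)⟩,
   ⟨(0, 0), (11, 1), (9, 0), (29, 0), (2, 1), (41, 1)⟩,
   ⟨(0, 0), (54, 1), (17, 0), (40, 0), (37, 1), (14, 1)⟩,
   ⟨(0, 0), (39, 1), (13, 0), (46, 0), (26, 1), (52, 1)⟩,
   ⟨(0, 1), (36, 0), (35, 0), (19, 0), (1, 1), (17, 1)⟩,
   ⟨(0, 1), (9, 0), (35, 0), (37, 0), (33, 1), (31, 1)⟩,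
   ⟨(0, 1), (41, 0), (20, 0), (37, 0), (21, 1), (4, 1)⟩,
   ⟨(0, 1), (44, 0), (52, 0), (29, 0), (51, 1), (15, 1)⟩,
   ⟨(0, 0), (9, 1), (51, 0), (57, 0), (17, 1), (11, 1)⟩,
   ⟨(0, 1), (33, 0), (4, 0), (27, 0), (29, 1), (6, 1)⟩,
   ⟨(0, 0), (19, 1), (5, 0), (19, 0), (14, 1), (0, 1)⟩,
   ⟨(0, 1), (51, 0), (17, 0), (10, 0), (34, 1), (41, 1)⟩,
   ⟨(0, 1), (25, 0), (28, 0), (8, 0), (56, 1), (17, 1)⟩,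
   ⟨(0, 0), (47, 1), (47, 0), (1, 0), (0, 1), (46, 1)⟩,
   ⟨(0, 0), (40, 1), (10, 0), (7, 0), (30, 1), (33, 1)⟩,
   ⟨(0, 0), (28, 1), (30, 0), (16, 0), (57, 1), (12, 1)⟩,
   ⟨(0, 0), (31, 1), (33, 0), (34, 0), (57, 1), (56, 1)⟩,
   ⟨(0, 1), (22, 0), (50, 0), (3, 0), (31, 1), (19, 1)⟩,
   ⟨(0, 1), (56, 0), (23, 0), (47, 0), (33, 1), (9, 1)⟩,
   ⟨(0, 0), (49, 1), (50, 0), (47, 0), (58, 1), (2, 1)⟩]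

/-- Fast evaluation of `List.count` on natural numbers. -/
def cntB (k : ℕ) (l : List ℕ) : ℕ := l.foldr (fun a n => bif Nat.beq a k then n + 1 else n) 0

lemma cntB_eq (k : ℕ) (l : List ℕ) : l.count k = cntB k l := by
  induction l with
  | nil => rfl
  | cons a l ih =>
    have h : cntB k (a :: l) = bif Nat.beq a k then cntB k l + 1 else cntB k l := rfl
    rw [h, List.count_cons, ih]
    by_cases hk : a = k
    · subst hk; simp
    · have : Nat.beq a k = false := by
        rw [Bool.eq_false_iff, Ne, Nat.beq_eq]; exact hk
      simp [this, hk]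

/-- Boolean test that all codes below `n` except the excluded ones have count two. -/
def cntAll (l : List ℕ) (ex : ℕ → Bool) : ℕ → Bool
  | 0 => true
  | n + 1 => (ex n || Nat.beq (cntB n l) 2) && cntAll l ex n

lemma cntAll_spec {l : List ℕ} {ex : ℕ → Bool} {n : ℕ} (h : cntAll l ex n = true) :
    ∀ k < n, ex k = true ∨ l.count k = 2 := by
  induction n with
  | zero => intro k hk; omega
  | succ n ih =>
    simp only [cntAll, Bool.and_eq_true, Bool.or_eq_true, Nat.beq_eq] at h
    intro k hk
    rcases Nat.lt_succ_iff_lt_or_eq.mp hk with hk | rfl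
    · exact ih h.2 k hk
    · rw [cntB_eq]; exact h.1

/-- Fast duplicate test by a bit mask. -/
def nodupM : ℕ → List ℕ → Bool
  | _, [] => true
  | acc, a :: l => !(Nat.testBit acc a) && nodupM (acc ||| 2 ^ a) l

lemma nodupM_spec (l : List ℕ) : ∀ acc, nodupM acc l = true →
    l.Nodup ∧ ∀ a ∈ l, Nat.testBit acc a = false := by
  induction l with
  | nil => intro acc _; simp
  | cons a l ih =>
    intro acc h
    simp only [nodupM, Bool.and_eq_true, Bool.not_eq_true'] at h
    obtain ⟨h1, h2⟩ := ih _ h.2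
    refine ⟨List.nodup_cons.mpr ⟨fun ha => ?_, h1⟩, ?_⟩
    · have := h2 a ha
      simp [Nat.testBit_or, Nat.testBit_two_pow_self] at this
    · intro b hb
      rcases List.mem_cons.mp hb with rfl | hb
      · exact h.1
      · have := h2 b hb
        simp only [Nat.testBit_or, Bool.or_eq_false_iff] at this
        exact this.1

lemma check_of (p m M : ℕ) (L : List Row) (h1 : ∀ B ∈ allB L, good p m B)
    (h2 : cntAll (codes p m L)
      (fun k => Nat.beq (k % p) 0 && Nat.beq (k / p % m) (k / p / m)) (m * m * p) = true)
    (h3 : nodupM 0 ((allB L ×ˢ List.range 4).map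
      (fun q => nkey p m (tri q.1 q.2) % M)) = true) : Check p m L where
  good := h1
  cnt := by
    intro c hc c' hc' d hd
    have hp : 0 < p := by omega
    have hm : 0 < m := by omega
    have hlt : (c * m + c') * p + d < m * m * p := by
      have e1 : c * m + c' + 1 ≤ m * m := by nlinarith
      nlinarith
    have e1 : ((c * m + c') * p + d) % p = d := by
      rw [Nat.mul_comm, Nat.mul_add_mod, Nat.mod_eq_of_lt hd]
    have e2 : ((c * m + c') * p + d) / p = c * m + c' := by
      rw [Nat.mul_comm, Nat.mul_add_div hp, Nat.div_eq_of_lt hd, Nat.add_zero]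
    have e3 : (c * m + c') % m = c' := by
      rw [Nat.mul_comm, Nat.mul_add_mod, Nat.mod_eq_of_lt hc']
    have e4 : (c * m + c') / m = c := by
      rw [Nat.mul_comm, Nat.mul_add_div hm, Nat.div_eq_of_lt hc', Nat.add_zero]
    refine (cntAll_spec h2 _ hlt).imp_left fun h => ?_
    simp only [Bool.and_eq_true, Nat.beq_eq, e1, e2, e3, e4] at h
    exact ⟨h.2.symm, h.1⟩
  keys := by
    have h := (nodupM_spec _ _ h3).1
    have h' : (((allB L ×ˢ List.range 4).map (fun q => nkey p m (tri q.1 q.2))).map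
        (fun k => k % M)).Nodup := by
      rw [List.map_map]; exact h
    exact List.Nodup.of_map _ h'

theorem check55 : Check 55 1 rows55 :=
  check_of 55 1 569 rows55 (by decide +kernel) (by decide +kernel) (by decide +kernel)

theorem check82 : Check 41 2 rows82 :=
  check_of 41 2 4231 rows82 (by decide +kernel) (by decide +kernel) (by decide +kernel)

theorem check85 : Check 85 1 rows85 :=
  check_of 85 1 1117 rows85 (by decide +kernel) (by decide +kernel) (by decide +kernel)

theorem check106 : Check 53 2 rows106 :=
  check_of 53 2 4546 rows106 (by decide +kernel) (by decide +kernel) (by decide +kernel)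

theorem check109 : Check 109 1 rows109 :=
  check_of 109 1 1623 rows109 (by decide +kernel) (by decide +kernel) (by decide +kernel)

theorem check118 : Check 59 2 rows118 :=
  check_of 59 2 8537 rows118 (by decide +kernel) (by decide +kernel) (by decide +kernel)

end Lemma15

/-- For every `v` in the given set there exists a super-simple
`2-(v,4,2)` directed design in which every defining set contains at least
half of the blocks. -/
theorem exists_superSimple_DD_half_lemma15 (v : ℕ)
    (hv : v ∈ ({55, 82, 85, 106, 109, 118} : Finset ℕ)) :
    ∃ D : DirectedDesign (Fin v) 2 4 2, D.SuperSimple ∧ D.DefiningHalf := by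
  simp only [Finset.mem_insert, Finset.mem_singleton] at hv
  rcases hv with rfl | rfl | rfl | rfl | rfl | rfl
  · exact Lemma15.build_fin 55 1 _ Lemma15.check55 (by norm_num)
  · exact Lemma15.build_fin 41 2 _ Lemma15.check82 (by norm_num)
  · exact Lemma15.build_fin 85 1 _ Lemma15.check85 (by norm_num)
  · exact Lemma15.build_fin 53 2 _ Lemma15.check106 (by norm_num)
  · exact Lemma15.build_fin 109 1 _ Lemma15.check109 (by norm_num)
  · exact Lemma15.build_fin 59 2 _ Lemma15.check118 (by norm_num)
end
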